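/- Let f be a minface on an open set U ⊆ R^2 with real Weierstrass data (g1, g2, ω1 du, ω2 dv) (so ω1 and ω2 are nowhere zero on U), and let p ∈ U be a singular point of f, i.e. g1(p)g2(p) = 1. Write φ1 = (g1)_u/(g1^2 ω1), φ2 = (g2)_v/(g2^2 ω2), Φ1 = (g1/(g1)_u)(φ1)_u, Φ2 = (g2/(g2)_v)(φ2)_v. Then f is A-equivalent at p to the cuspidal S_1^+ singularity f_{CS1+}(u,v) = (u, v^2, v^3(u^2 + v^2)) at the origin if and only if, at p: φ1 - φ2 = 0, φ1 + φ2 ≠ 0, Φ1 + Φ2 = 0, and (g1/(g1)_u)(Φ1)_u - (g2/(g2)_v)(Φ2)_v ≠ 0. -/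

import Mathlib

noncomputable section

open Real Filter

abbrev R2 : Type := ℝ × ℝ
abbrev R3 : Type := ℝ × ℝ × ℝ

/-- The partial derivative in the `u`-direction. -/
def pu (f : R2 → R3) (p : R2) : R3 := fderiv ℝ f p (1, 0)
/-- The partial derivative in the `v`-direction. -/
def pv (f : R2 → R3) (p : R2) : R3 := fderiv ℝ f p (0, 1)

/-- Determinant of three column vectors in ℝ³. -/
def det3 (a b c : R3) : ℝ :=
  a.1 * (b.2.1 * c.2.2 - b.2.2 * c.2.1)
  - b.1 * (a.2.1 * c.2.2 - a.2.2 * c.2.1)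
  + c.1 * (a.2.1 * b.2.2 - a.2.2 * b.2.1)

/-- Determinant of two vectors in ℝ². -/
def det2 (a b : R2) : ℝ := a.1 * b.2 - a.2 * b.1

/-- Euclidean inner product on ℝ³. -/
def ip3 (a b : R3) : ℝ := a.1 * b.1 + a.2.1 * b.2.1 + a.2.2 * b.2.2

/-- `f : ℝ² → ℝ³ = 𝕃³` is the generalized timelike minimal surface with real Weierstrass
data `(g1, g2, w1 du, w2 dv)`: it is smooth, its partial derivatives are
`f_u = (ω1/2)·(-1-g1², 1-g1², 2g1)` and `f_v = (ω2/2)·(1+g2², 1-g2², -2g2)`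
(which encodes the Weierstrass-type integral representation), and it is an immersion
on an open dense set. -/
structure IsGTMS (f : R2 → R3) (g1 g2 w1 w2 : ℝ → ℝ) : Prop where
  smooth_f : ContDiff ℝ (⊤ : ℕ∞) f
  smooth_g1 : ContDiff ℝ (⊤ : ℕ∞) g1
  smooth_g2 : ContDiff ℝ (⊤ : ℕ∞) g2
  smooth_w1 : ContDiff ℝ (⊤ : ℕ∞) w1
  smooth_w2 : ContDiff ℝ (⊤ : ℕ∞) w2
  deriv_u : ∀ p : R2, pu f p =
    ((-1 - g1 p.1 ^ 2) * w1 p.1 / 2, (1 - g1 p.1 ^ 2) * w1 p.1 / 2, g1 p.1 * w1 p.1)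
  deriv_v : ∀ p : R2, pv f p =
    ((1 + g2 p.2 ^ 2) * w2 p.2 / 2, (1 - g2 p.2 ^ 2) * w2 p.2 / 2, -(g2 p.2 * w2 p.2))
  dense_immersion : Dense {p : R2 | Function.Injective (fderiv ℝ f p)}

/-- `Φ` is a germ of diffeomorphism at `p`. -/
def IsLocalDiffeoAt {E F : Type*} [NormedAddCommGroup E] [NormedSpace ℝ E]
    [NormedAddCommGroup F] [NormedSpace ℝ F] (Φ : E → F) (p : E) : Prop :=
  ∃ (U : Set E) (V : Set F) (Φinv : F → E),
    IsOpen U ∧ p ∈ U ∧ IsOpen V ∧ Φ p ∈ V ∧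
    ContDiffOn ℝ (⊤ : ℕ∞) Φ U ∧ ContDiffOn ℝ (⊤ : ℕ∞) Φinv V ∧
    Set.MapsTo Φ U V ∧ Set.MapsTo Φinv V U ∧
    (∀ x ∈ U, Φinv (Φ x) = x) ∧ (∀ y ∈ V, Φ (Φinv y) = y)

/-- 𝒜-equivalence of the germ of `f1` at `p1` and the germ of `f2` at `p2`. -/
def AEquiv (f1 : R2 → R3) (p1 : R2) (f2 : R2 → R3) (p2 : R2) : Prop :=
  ∃ (Φ : R2 → R2) (Ψ : R3 → R3),
    IsLocalDiffeoAt Φ p1 ∧ Φ p1 = p2 ∧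
    IsLocalDiffeoAt Ψ (f1 p1) ∧ Ψ (f1 p1) = f2 p2 ∧
    ∀ᶠ x in nhds p1, Ψ (f1 x) = f2 (Φ x)

/-- The canonical unit normal of a generalized timelike minimal surface. -/
def gtmsNormal (g1 g2 : ℝ → ℝ) (p : R2) : R3 :=
  (Real.sqrt ((1 - g1 p.1 * g2 p.2) ^ 2 + 2 * (g1 p.1 + g2 p.2) ^ 2))⁻¹ •
    (g1 p.1 + g2 p.2, -g1 p.1 + g2 p.2, 1 + g1 p.1 * g2 p.2)

/-- The signed area density function `λ = det(f_u, f_v, n)`. -/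
def areaDensity (f : R2 → R3) (g1 g2 : ℝ → ℝ) (p : R2) : ℝ :=
  det3 (pu f p) (pv f p) (gtmsNormal g1 g2 p)

/-- `f` is a front at `p`: the Legendrian lift `(f, n)` is an immersion at `p`,
where `n` is the canonical unit normal. -/
def IsFrontAt (f : R2 → R3) (g1 g2 : ℝ → ℝ) (p : R2) : Prop :=
  Function.Injective (fderiv ℝ (fun q => (f q, gtmsNormal g1 g2 q)) p)

/-- The differential of `f` at `p` has rank one. -/
def RankOne (f : R2 → R3) (p : R2) : Prop :=
  LinearMap.rank (fderiv ℝ f p).toLinearMap = 1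

/-- Directional derivative of `F` along the vector field `X`. -/
def vD (X : R2 → R2) (F : R2 → R3) : R2 → R3 := fun q => fderiv ℝ F q (X q)

/-- `φ_i = g_i' / (g_i² ω_i)`. -/
def phiW (g w : ℝ → ℝ) : ℝ → ℝ := fun t => deriv g t / (g t ^ 2 * w t)
/-- `Φ_i = (g_i/g_i') φ_i'`. -/
def PhiW (g w : ℝ → ℝ) : ℝ → ℝ := fun t => g t / deriv g t * deriv (phiW g w) t

/-- standard cuspidal butterfly -/
def fCBF : R2 → R3 := fun q =>
  (q.1, 5 * q.2 ^ 4 + 2 * q.1 * q.2, 4 * q.2 ^ 5 + q.1 * q.2 ^ 2 - q.1 ^ 2)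
/-- standard cuspidal S₁⁺ singularity -/
def fCS1p : R2 → R3 := fun q => (q.1, q.2 ^ 2, q.2 ^ 3 * (q.1 ^ 2 + q.2 ^ 2))
/-- standard cuspidal S₁⁻ singularity -/
def fCS1m : R2 → R3 := fun q => (q.1, q.2 ^ 2, q.2 ^ 3 * (q.1 ^ 2 - q.2 ^ 2))
/-- standard cuspidal edge -/
def fCE : R2 → R3 := fun q => (q.1, q.2 ^ 2, q.2 ^ 3)
/-- standard (2,5)-cuspidal edge -/
def fCE25 : R2 → R3 := fun q => (q.1, q.2 ^ 2, q.2 ^ 5)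
/-- standard cuspidal beaks -/
def fCBK : R2 → R3 := fun q =>
  (q.2, q.1 ^ 3 - q.1 * q.2 ^ 2, 3 * q.1 ^ 4 - 2 * q.1 ^ 2 * q.2 ^ 2)
/-- standard cuspidal lips -/
def fCLP : R2 → R3 := fun q =>
  (q.2, q.1 ^ 3 + q.1 * q.2 ^ 2, 3 * q.1 ^ 4 + 2 * q.1 ^ 2 * q.2 ^ 2)
/-- standard D₄⁺ singularity -/
def fD4p : R2 → R3 := fun q =>
  (q.1 * q.2, q.1 ^ 2 + 3 * q.2 ^ 2, q.1 ^ 2 * q.2 + q.2 ^ 3)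
/-- standard D₄⁻ singularity -/
def fD4m : R2 → R3 := fun q =>
  (q.1 * q.2, q.1 ^ 2 - 3 * q.2 ^ 2, q.1 ^ 2 * q.2 - q.2 ^ 3)

theorem IsLocalDiffeoAt.comp {E F G : Type*} [NormedAddCommGroup E] [NormedSpace ℝ E]
    [NormedAddCommGroup F] [NormedSpace ℝ F] [NormedAddCommGroup G] [NormedSpace ℝ G]
    {Ψ : F → G} {Φ : E → F} {p : E} (hΨ : IsLocalDiffeoAt Ψ (Φ p)) (hΦ : IsLocalDiffeoAt Φ p) :
    IsLocalDiffeoAt (Ψ ∘ Φ) p := by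
  obtain ⟨U, V, i, hU, hpU, hV, hpV, h1, h2, h3, h4, h5, h6⟩ := hΦ
  obtain ⟨U', V', i', hU', hpU', hV', hpV', h1', h2', h3', h4', h5', h6'⟩ := hΨ
  refine ⟨U ∩ Φ ⁻¹' U', V' ∩ i' ⁻¹' V, i ∘ i', h1.continuousOn.isOpen_inter_preimage hU hU',
    ⟨hpU, hpU'⟩, h2'.continuousOn.isOpen_inter_preimage hV' hV,
    ⟨hpV', by simpa [h5' _ hpU'] using hpV⟩, ?_, ?_, ?_, ?_, ?_, ?_⟩
  · exact h1'.comp (h1.mono Set.inter_subset_left) fun x hx => hx.2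
  · exact h2.comp (h2'.mono Set.inter_subset_left) fun x hx => hx.2
  · rintro x ⟨hx, hx'⟩
    exact ⟨h3' hx', by simpa [h5' _ hx'] using h3 hx⟩
  · rintro y ⟨hy, hy'⟩
    exact ⟨h4 hy', by simpa [h6 _ hy'] using h4' hy⟩
  · rintro x ⟨hx, hx'⟩
    simp [h5' _ hx', h5 _ hx]
  · rintro y ⟨hy, hy'⟩
    simp [h6 _ hy', h6' _ hy]

theorem isLocalDiffeoAt_of_contDiffOn {E : Type*} [NormedAddCommGroup E] [NormedSpace ℝ E]
    [FiniteDimensional ℝ E] {Φ : E → E} {U : Set E} (hU : IsOpen U) {p : E} (hp : p ∈ U)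
    (hΦ : ContDiffOn ℝ (⊤ : ℕ∞) Φ U) (hinj : Function.Injective (fderiv ℝ Φ p)) :
    IsLocalDiffeoAt Φ p := by
  have : CompleteSpace E := FiniteDimensional.complete ℝ E
  have hat : ∀ x ∈ U, ContDiffAt ℝ (⊤ : ℕ∞) Φ x := fun x hx => hΦ.contDiffAt (hU.mem_nhds hx)
  have h0 : ((⊤ : ℕ∞) : WithTop ℕ∞) ≠ 0 := by simp
  have hequiv : ∀ L : E →L[ℝ] E, Function.Injective L → ∃ e : E ≃L[ℝ] E, (e : E →L[ℝ] E) = L := by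
    intro L hL
    refine ⟨(LinearEquiv.ofInjectiveEndo L.toLinearMap hL).toContinuousLinearEquiv, ?_⟩
    ext x; rfl
  obtain ⟨e, he⟩ := hequiv _ hinj
  have hd : HasFDerivAt Φ (e : E →L[ℝ] E) p := by
    rw [he]; exact ((hat p hp).differentiableAt h0).hasFDerivAt
  set H := (hat p hp).toOpenPartialHomeomorph Φ hd h0 with hH
  have hHc : (H : E → E) = Φ := (hat p hp).toOpenPartialHomeomorph_coe hd h0
  have hpH : p ∈ H.source := (hat p hp).mem_toOpenPartialHomeomorph_source hd h0
  have hcf : ContinuousOn (fderiv ℝ Φ) U := hΦ.continuousOn_fderiv_of_isOpen hU (by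
    exact_mod_cast (le_top : (1 : ℕ∞) ≤ ⊤))
  have hO : IsOpen (U ∩ fderiv ℝ Φ ⁻¹' Set.range ((↑) : (E ≃L[ℝ] E) → (E →L[ℝ] E))) :=
    hcf.isOpen_inter_preimage hU ContinuousLinearEquiv.isOpen
  set W := H.source ∩ (U ∩ fderiv ℝ Φ ⁻¹' Set.range ((↑) : (E ≃L[ℝ] E) → (E →L[ℝ] E))) with hW
  have hWo : IsOpen W := H.open_source.inter hO
  have hpW : p ∈ W := ⟨hpH, hp, ⟨e, he⟩⟩
  refine ⟨W, H.target ∩ H.symm ⁻¹' W, H.symm, hWo, hpW,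
    H.isOpen_inter_preimage_symm hWo, ⟨?_, ?_⟩, ?_, ?_, ?_, ?_, ?_, ?_⟩
  · rw [← hHc]; exact H.map_source hpH
  · rw [← hHc]; simpa [H.left_inv hpH] using hpW
  · exact hΦ.mono fun x hx => hx.2.1
  · rintro y ⟨hy, hy'⟩
    obtain ⟨e', he'⟩ := hy'.2.2
    refine (H.contDiffAt_symm hy (f₀' := e') ?_ ?_).contDiffWithinAt
    · rw [hHc, he']
      exact ((hat _ hy'.2.1).differentiableAt h0).hasFDerivAt
    · rw [hHc]; exact hat _ hy'.2.1
  · intro x hx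
    rw [← hHc]
    refine ⟨H.map_source hx.1, ?_⟩
    simpa [H.left_inv hx.1] using hx
  · rintro y ⟨hy, hy'⟩
    exact hy'
  · intro x hx
    rw [← hHc]; exact H.left_inv hx.1
  · rintro y ⟨hy, hy'⟩
    rw [← hHc]; exact H.right_inv hy

theorem AEquiv.trans {f1 f2 f3 : R2 → R3} {p1 p2 p3 : R2}
    (h12 : AEquiv f1 p1 f2 p2) (h23 : AEquiv f2 p2 f3 p3) : AEquiv f1 p1 f3 p3 := by
  obtain ⟨Φ, Ψ, hΦ, hΦp, hΨ, hΨp, h⟩ := h12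
  obtain ⟨Φ', Ψ', hΦ', hΦp', hΨ', hΨp', h'⟩ := h23
  have hcΦ : ContinuousAt Φ p1 := by
    obtain ⟨U, V, i, hU, hpU, hV, hpV, h1, -⟩ := hΦ
    exact h1.continuousOn.continuousAt (hU.mem_nhds hpU)
  refine ⟨Φ' ∘ Φ, Ψ' ∘ Ψ, .comp (by rwa [hΦp]) hΦ, by simp [hΦp, hΦp'],
    .comp (by rwa [hΨp]) hΨ, by simp [hΨp, hΨp'], ?_⟩
  have := hcΦ.eventually (by rwa [hΦp])
  filter_upwards [h, this] with x hx hx'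
  simp [hx, hx']

theorem contDiff_intervalIntegral_param {E F : Type} [NormedAddCommGroup E] [NormedSpace ℝ E]
    [FiniteDimensional ℝ E] [NormedAddCommGroup F] [NormedSpace ℝ F] [CompleteSpace F]
    {K : E × ℝ → F} (hK : ContDiff ℝ (⊤ : ℕ∞) K) :
    ContDiff ℝ (⊤ : ℕ∞) fun x => ∫ t in (0 : ℝ)..1, K (x, t) := by
  have key : ∀ n : ℕ, ∀ (F : Type) [NormedAddCommGroup F] [NormedSpace ℝ F] [CompleteSpace F]
      (K : E × ℝ → F), ContDiff ℝ (⊤ : ℕ∞) K →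
      ContDiff ℝ n fun x => ∫ t in (0 : ℝ)..1, K (x, t) := by
    intro n
    have hder : ∀ (F : Type) [NormedAddCommGroup F] [NormedSpace ℝ F] [CompleteSpace F]
        (K : E × ℝ → F), ContDiff ℝ (⊤ : ℕ∞) K → ∀ x,
        HasFDerivAt (fun x => ∫ t in (0 : ℝ)..1, K (x, t))
          (∫ t in (0 : ℝ)..1, (fderiv ℝ K (x, t)).comp (ContinuousLinearMap.inl ℝ E ℝ)) x := by
      intro F _ _ _ K hK x
      have hcont : Continuous fun q : E × ℝ =>
          (fderiv ℝ K q).comp (ContinuousLinearMap.inl ℝ E ℝ) :=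
        (hK.continuous_fderiv (by simp)).clm_comp continuous_const
      obtain ⟨C, hC⟩ := ((isCompact_closedBall x 1).prod (isCompact_Icc (a := (0 : ℝ)) (b := 1))
        ).exists_bound_of_continuousOn hcont.continuousOn
      have hfix : ∀ x : E, Continuous fun t : ℝ => ((x, t) : E × ℝ) := fun x => by fun_prop
      refine intervalIntegral.hasFDerivAt_integral_of_dominated_of_fderiv_le
        (F := fun x t => K (x, t))
        (F' := fun x t => (fderiv ℝ K (x, t)).comp (ContinuousLinearMap.inl ℝ E ℝ))
        (s := Metric.ball x 1) (bound := fun _ => C) (Metric.ball_mem_nhds x one_pos)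
        (Eventually.of_forall fun y =>
          ((hK.continuous.comp (hfix y)).aestronglyMeasurable))
        ((hK.continuous.comp (hfix x)).intervalIntegrable _ _)
        ((hcont.comp (hfix x)).aestronglyMeasurable)
        (Eventually.of_forall fun t ht y hy => ?_) (by simp)
        (Eventually.of_forall fun t _ y _ => ?_)
      · refine hC (y, t) ⟨Metric.ball_subset_closedBall hy, ?_⟩
        rw [Set.uIoc_of_le zero_le_one] at ht
        exact ⟨ht.1.le, ht.2⟩
      · have h1 : HasFDerivAt (fun y : E => ((y, t) : E × ℝ)) (ContinuousLinearMap.inl ℝ E ℝ) y :=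
          hasFDerivAt_prodMk_left y t
        exact ((hK.differentiable (by simp)) (y, t)).hasFDerivAt.comp y h1
    induction n with
    | zero =>
      intro F _ _ _ K hK
      exact contDiff_zero.2
        (continuous_iff_continuousAt.2 fun x => (hder F K hK x).continuousAt)
    | succ n ih =>
      intro F _ _ _ K hK
      rw [Nat.cast_succ, contDiff_succ_iff_hasFDerivAt]
      refine ⟨_, ih _ (fun q => (fderiv ℝ K q).comp (ContinuousLinearMap.inl ℝ E ℝ)) ?_,
        hder F K hK⟩
      exact (hK.fderiv_right (m := (⊤ : ℕ∞)) (by simp)).clm_comp contDiff_const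
  exact contDiff_infty.2 fun n => key n F K hK

/-- Hadamard's lemma in the second variable. -/
theorem exists_contDiff_eq_add_snd_mul {F : R2 → ℝ} (hF : ContDiff ℝ (⊤ : ℕ∞) F) :
    ∃ K : R2 → ℝ, ContDiff ℝ (⊤ : ℕ∞) K ∧ ∀ x y, F (x, y) = F (x, 0) + y * K (x, y) := by
  refine ⟨fun q => ∫ t in (0 : ℝ)..1, fderiv ℝ F (q.1, t * q.2) (0, 1), ?_, fun x y => ?_⟩
  · refine contDiff_intervalIntegral_param
      (K := fun z : R2 × ℝ => fderiv ℝ F (z.1.1, z.2 * z.1.2) (0, 1)) ?_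
    have := hF.fderiv_right (m := (⊤ : ℕ∞)) (by simp)
    fun_prop
  · have hd : ∀ t ∈ Set.uIcc (0 : ℝ) 1, HasDerivAt (fun t : ℝ => F (x, t * y))
        (y * fderiv ℝ F (x, t * y) (0, 1)) t := by
      intro t _
      have h1 : HasDerivAt (fun t : ℝ => ((x, t * y) : R2)) (0, y) t := by
        simpa using (hasDerivAt_const t x).prodMk ((hasDerivAt_id t).mul_const y)
      have h2 := ((hF.differentiable (by simp)) (x, t * y)).hasFDerivAt.comp_hasDerivAt t h1
      have h3 : fderiv ℝ F (x, t * y) (0, y) = y * fderiv ℝ F (x, t * y) (0, 1) := by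
        have : ((0, y) : R2) = y • (0, 1) := by simp
        rw [this, map_smul, smul_eq_mul]
      rwa [h3] at h2
    have hc : Continuous fun t : ℝ => y * fderiv ℝ F (x, t * y) (0, 1) := by
      have := hF.continuous_fderiv (by simp)
      fun_prop
    have := intervalIntegral.integral_eq_sub_of_hasDerivAt hd (hc.intervalIntegrable _ _)
    rw [intervalIntegral.integral_const_mul] at this
    simp only [one_mul, zero_mul] at this
    linarith

/-- A function smooth near a point agrees near that point with a smooth compactly supported one. -/
theorem exists_contDiff_eventuallyEq {E : Type*} [NormedAddCommGroup E] [NormedSpace ℝ E]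
    [FiniteDimensional ℝ E] {E' : Type*} [NormedAddCommGroup E'] [NormedSpace ℝ E'] {F : E → E'}
    {U : Set E} (hU : IsOpen U) {p : E} (hp : p ∈ U) (hF : ContDiffOn ℝ (⊤ : ℕ∞) F U) :
    ∃ G : E → E', ContDiff ℝ (⊤ : ℕ∞) G ∧ HasCompactSupport G ∧ G =ᶠ[nhds p] F := by
  obtain ⟨r, hr, hrU⟩ := Metric.isOpen_iff.1 hU p hp
  let χ : ContDiffBump p := ⟨r / 4, r / 2, by positivity, by linarith⟩
  have hsupp : tsupport (χ : E → ℝ) ⊆ U := by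
    rw [χ.tsupport_eq]
    exact (Metric.closedBall_subset_ball (show r / 2 < r by linarith)).trans hrU
  refine ⟨fun x => χ x • F x, ?_, χ.hasCompactSupport.smul_right, ?_⟩
  · rw [contDiff_iff_contDiffAt]
    intro x
    by_cases hx : x ∈ tsupport (χ : E → ℝ)
    · exact χ.contDiffAt.smul (hF.contDiffAt (hU.mem_nhds (hsupp hx)))
    · have : (fun x => χ x • F x) =ᶠ[nhds x] fun _ => 0 := by
        filter_upwards [(isClosed_tsupport _).isOpen_compl.mem_nhds hx] with y hy
        rw [image_eq_zero_of_notMem_tsupport hy, zero_smul]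
      exact contDiffAt_const.congr_of_eventuallyEq this
  · filter_upwards [χ.eventuallyEq_one] with x hx
    simp [hx]

theorem exists_contDiff_comp_sq_eq_cos :
    ∃ C : ℝ → ℝ, ContDiff ℝ (⊤ : ℕ∞) C ∧ ∀ y, C (y ^ 2) = cos y := by
  set c : ℕ → ℝ := fun n => (-1) ^ n / (2 * n).factorial with hc
  set p := FormalMultilinearSeries.ofScalars ℝ c with hp
  have hrad : p.radius = ⊤ := by
    refine FormalMultilinearSeries.ofScalars_radius_eq_top_of_tendsto ℝ c
      (Eventually.of_forall fun n => ?_) ?_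
    · simp only [hc]; positivity
    · have h1 : ∀ n : ℕ, ‖c n.succ‖ / ‖c n‖ = 1 / (((2 * n : ℕ) : ℝ) + 1) * (1 / ((2 * n + 1 : ℕ) + 1)) := by
        intro n
        have : (2 * n.succ).factorial = (2 * n + 2) * ((2 * n + 1) * (2 * n).factorial) := by
          rw [show 2 * n.succ = 2 * n + 1 + 1 by omega, Nat.factorial_succ, Nat.factorial_succ]
        simp only [hc, norm_div, norm_pow, norm_neg, norm_one, one_pow, this]
        have h2 : ((2 * n).factorial : ℝ) ≠ 0 := by positivity
        have h3 : |(2 * n + 2 : ℝ)| = 2 * n + 2 := abs_of_pos (by positivity)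
        have h4 : |(2 * n + 1 : ℝ)| = 2 * n + 1 := abs_of_pos (by positivity)
        simp [h3, h4]
        field_simp
        ring
      simp_rw [h1]
      have h2 := (tendsto_one_div_add_atTop_nhds_zero_nat (𝕜 := ℝ))
      have h3 : Tendsto (fun n : ℕ => 2 * n) atTop atTop :=
        tendsto_atTop_mono (fun n => by simp only [id]; omega) tendsto_id
      have h4 : Tendsto (fun n : ℕ => 2 * n + 1) atTop atTop :=
        (tendsto_add_atTop_nat 1).comp h3
      simpa using (h2.comp h3).mul (h2.comp h4)
  have hps : HasFPowerSeriesOnBall p.sum p 0 ⊤ := by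
    simpa [hrad] using p.hasFPowerSeriesOnBall (by simp [hrad])
  refine ⟨p.sum, ?_, fun y => ?_⟩
  · rw [contDiff_iff_contDiffAt]
    intro x
    exact (hps.analyticAt_of_mem (by simp)).contDiffAt
  · have h1 := hps.hasSum (y := y ^ 2) (by simp)
    rw [zero_add] at h1
    have h2 : (fun n => p n fun _ => y ^ 2) =
        fun n => (-1) ^ n * y ^ (2 * n) / (2 * n).factorial := by
      funext n
      simp [hp, hc, FormalMultilinearSeries.ofScalars, pow_mul]
      ring
    rw [h2] at h1
    exact h1.unique (hasSum_cos y)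

theorem exists_cos_sqrt_extension :
    ∃ E : ℝ → ℝ, ContDiff ℝ (⊤ : ℕ∞) E ∧ (∀ y, E (y ^ 2) = cos y) ∧
      ∀ k, ∃ B, ∀ r, |iteratedDeriv k E r| ≤ B := by
  obtain ⟨C, hC, hcos⟩ := exists_contDiff_comp_sq_eq_cos
  have hD : ∀ k r, HasDerivAt (iteratedDeriv k C) (iteratedDeriv (k + 1) C r) r := by
    intro k r
    rw [iteratedDeriv_succ]
    exact ((hC.differentiable_iteratedDeriv k (by exact_mod_cast WithTop.coe_lt_top _)) r).hasDerivAt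
  have h1 : ∀ y : ℝ, iteratedDeriv 1 C (y ^ 2) * (2 * y) = - sin y := by
    intro y
    have h := (hD 0 (y ^ 2)).comp y (hasDerivAt_pow 2 y)
    have h' : (iteratedDeriv 0 C ∘ fun y : ℝ => y ^ 2) = cos := by
      funext z; simp [hcos]
    rw [h'] at h
    simpa using h.unique (hasDerivAt_cos y)
  have h2 : ∀ r, 0 < r →
      4 * r * iteratedDeriv 2 C r + 2 * iteratedDeriv 1 C r + iteratedDeriv 0 C r = 0 := by
    intro r hr
    have h := ((hD 1 (√r ^ 2)).comp (√r) (hasDerivAt_pow 2 (√r))).mul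
      ((hasDerivAt_id (√r)).const_mul 2)
    have h' : ((iteratedDeriv 1 C ∘ fun y : ℝ => y ^ 2) * fun y : ℝ => 2 * id y) =
        fun y => - sin y := by
      funext z; simp [← h1 z]
    rw [h'] at h
    have h3 := h.unique (hasDerivAt_sin (√r)).neg
    have h4 : C r = cos (√r) := by rw [← hcos, sq_sqrt hr.le]
    simp [sq_sqrt hr.le] at h3
    have h5 : √r * √r = r := mul_self_sqrt hr.le
    simp only [iteratedDeriv_zero, h4]
    simp only [iteratedDeriv_one]
    linear_combination h3 - 4 * iteratedDeriv 2 C r * h5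
  have h3 : ∀ k : ℕ, ∀ r, 0 < r → 4 * r * iteratedDeriv (k + 2) C r +
      (4 * k + 2) * iteratedDeriv (k + 1) C r + iteratedDeriv k C r = 0 := by
    intro k
    induction k with
    | zero => intro r hr; simpa using h2 r hr
    | succ k ih =>
      intro r hr
      have h := ((((hasDerivAt_id r).const_mul 4).mul (hD (k + 2) r)).add
        ((hD (k + 1) r).const_mul (4 * (k : ℝ) + 2))).add (hD k r)
      have h' : HasDerivAt (fun _ : ℝ => (0 : ℝ)) 0 r := hasDerivAt_const r 0
      have h0 := h.unique (h'.congr_of_eventuallyEq ?_)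
      · simp only [id] at h0
        push_cast
        rw [show k + 1 + 2 = k + 2 + 1 by ring, show k + 1 + 1 = k + 2 by ring]
        rw [show k + 1 + 1 = k + 2 by ring] at h0
        linear_combination h0
      · filter_upwards [lt_mem_nhds hr] with s hs
        simpa using ih s hs
  have h4 : ∀ k : ℕ, ∃ B, ∀ r, 1 ≤ r → |iteratedDeriv k C r| ≤ B := by
    intro k
    induction k using Nat.twoStepInduction with
    | zero =>
      refine ⟨1, fun r hr => ?_⟩
      rw [iteratedDeriv_zero, ← sq_sqrt (show 0 ≤ r by linarith), hcos]
      exact abs_cos_le_one _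
    | one =>
      refine ⟨1, fun r hr => ?_⟩
      have h := h1 (√r)
      rw [sq_sqrt (show 0 ≤ r by linarith)] at h
      have hs : 1 ≤ √r := one_le_sqrt.2 hr
      have h5 : |iteratedDeriv 1 C r| * (2 * √r) ≤ 1 := by
        have := abs_sin_le_one (√r)
        rw [← abs_neg, ← h, abs_mul, abs_of_nonneg (show 0 ≤ 2 * √r by positivity)] at this
        exact this
      nlinarith [abs_nonneg (iteratedDeriv 1 C r)]
    | more k ih0 ih1 =>
      obtain ⟨B0, h0⟩ := ih0
      obtain ⟨B1, h1⟩ := ih1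
      refine ⟨((4 * k + 2) * B1 + B0) / 4, fun r hr => ?_⟩
      have h := h3 k r (by linarith)
      have e0 := h0 r hr
      have e1 := h1 r hr
      have h5 : |4 * r * iteratedDeriv (k + 2) C r| ≤ (4 * k + 2) * B1 + B0 := by
        rw [show 4 * r * iteratedDeriv (k + 2) C r =
          -((4 * k + 2) * iteratedDeriv (k + 1) C r) + -iteratedDeriv k C r by linear_combination h]
        refine (abs_add_le _ _).trans (add_le_add ?_ (by rwa [abs_neg]))
        rw [abs_neg, abs_mul, abs_of_nonneg (show (0 : ℝ) ≤ 4 * k + 2 by positivity)]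
        gcongr
      rw [abs_mul, abs_of_nonneg (show 0 ≤ 4 * r by linarith)] at h5
      nlinarith [abs_nonneg (iteratedDeriv (k + 2) C r)]
  set E : ℝ → ℝ := fun r => smoothTransition (r + 2) * C r with hE
  have hEs : ContDiff ℝ (⊤ : ℕ∞) E :=
    (smoothTransition.contDiff.comp (contDiff_id.add contDiff_const)).mul hC
  refine ⟨E, hEs, fun y => ?_, fun k => ?_⟩
  · simp only [hE]
    rw [smoothTransition.one_of_one_le (by nlinarith), one_mul, hcos]
  · obtain ⟨B, hB⟩ := h4 k
    have hcont : Continuous (iteratedDeriv k E) :=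
      hEs.continuous_iteratedDeriv k (by exact_mod_cast le_top)
    obtain ⟨B', hB'⟩ := (isCompact_Icc (a := (-2 : ℝ)) (b := 1)).exists_bound_of_continuousOn
      hcont.continuousOn
    refine ⟨max B (max B' 0), fun r => ?_⟩
    rcases lt_or_ge r (-2) with hr | hr
    · have : E =ᶠ[nhds r] fun _ => 0 := by
        filter_upwards [gt_mem_nhds hr] with s hs
        simp [hE, smoothTransition.zero_of_nonpos (show s + 2 ≤ 0 by linarith)]
      rw [this.iteratedDeriv_eq]
      simp
    rcases le_or_gt r 1 with hr1 | hr1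
    · exact (hB' r ⟨hr, hr1⟩).trans (by simp)
    · have : E =ᶠ[nhds r] C := by
        filter_upwards [lt_mem_nhds hr1] with s hs
        simp [hE, smoothTransition.one_of_one_le (show 1 ≤ s + 2 by linarith)]
      rw [this.iteratedDeriv_eq]
      exact (hB r hr1.le).trans (by simp)

/-- Measurable functions all of whose moments are integrable. -/
def HasIntegrableMoments (h : EuclideanSpace ℝ (Fin 2) → ℂ) : Prop :=
  MeasureTheory.AEStronglyMeasurable h ∧
    ∀ k : ℕ, MeasureTheory.Integrable fun ξ => ‖ξ‖ ^ k * ‖h ξ‖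

/-- Smooth functions with all derivatives bounded. -/
def HasBoundedDerivs (E : ℝ → ℝ) : Prop :=
  ContDiff ℝ (⊤ : ℕ∞) E ∧ ∀ k, ∃ B, ∀ r, |iteratedDeriv k E r| ≤ B

theorem HasBoundedDerivs.deriv {E : ℝ → ℝ} (hE : HasBoundedDerivs E) :
    HasBoundedDerivs (deriv E) := by
  refine ⟨(contDiff_infty_iff_deriv.1 hE.1).2, fun k => ?_⟩
  rw [← iteratedDeriv_succ']
  exact hE.2 (k + 1)

theorem HasIntegrableMoments.mul_continuous {h : EuclideanSpace ℝ (Fin 2) → ℂ}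
    (hh : HasIntegrableMoments h) {m : EuclideanSpace ℝ (Fin 2) → ℂ} (hm : Continuous m)
    {C : ℝ} {j : ℕ} (hC : ∀ ξ, ‖m ξ‖ ≤ C * ‖ξ‖ ^ j) :
    HasIntegrableMoments fun ξ => h ξ * m ξ := by
  refine ⟨hh.1.mul hm.aestronglyMeasurable, fun k => ?_⟩
  refine ((hh.2 (k + j)).const_mul C).mono' ?_ (Eventually.of_forall fun ξ => ?_)
  · exact (continuous_norm.pow k).aestronglyMeasurable.mul
      (hh.1.mul hm.aestronglyMeasurable).norm
  · rw [norm_mul, norm_pow, norm_norm, norm_norm, norm_mul]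
    calc ‖ξ‖ ^ k * (‖h ξ‖ * ‖m ξ‖) ≤ ‖ξ‖ ^ k * (‖h ξ‖ * (C * ‖ξ‖ ^ j)) := by
          gcongr; exact hC ξ
      _ = C * (‖ξ‖ ^ (k + j) * ‖h ξ‖) := by ring

/-- The oscillatory kernel `exp (2πi ξ₀ x) E ((2π ξ₁)² w)`. -/
def foldKernel (E : ℝ → ℝ) (q : R2) (ξ : EuclideanSpace ℝ (Fin 2)) : ℂ :=
  Complex.exp ((2 * π * ξ 0 * q.1 : ℝ) * Complex.I) * (E ((2 * π * ξ 1) ^ 2 * q.2) : ℝ)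

theorem norm_foldKernel_le {E : ℝ → ℝ} {B : ℝ} (hB : ∀ r, |E r| ≤ B) (q : R2)
    (ξ : EuclideanSpace ℝ (Fin 2)) : ‖foldKernel E q ξ‖ ≤ B := by
  rw [foldKernel, norm_mul, Complex.norm_exp_ofReal_mul_I, one_mul, Complex.norm_real]
  exact hB _

theorem continuous_foldKernel {E : ℝ → ℝ} (hE : Continuous E) (q : R2) :
    Continuous (foldKernel E q) := by
  unfold foldKernel
  fun_prop

/-- The superposition of the kernels `foldKernel E` with density `h`. -/
def foldIntegral (h : EuclideanSpace ℝ (Fin 2) → ℂ) (E : ℝ → ℝ) (q : R2) : ℂ :=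
  ∫ ξ, h ξ * foldKernel E q ξ

theorem HasIntegrableMoments.integrable_mul_foldKernel {h : EuclideanSpace ℝ (Fin 2) → ℂ}
    (hh : HasIntegrableMoments h) {E : ℝ → ℝ} (hE : HasBoundedDerivs E) (q : R2) :
    MeasureTheory.Integrable fun ξ => h ξ * foldKernel E q ξ := by
  obtain ⟨B, hB⟩ := hE.2 0
  simp only [iteratedDeriv_zero] at hB
  refine ((hh.2 0).const_mul B).mono'
    (hh.1.mul (continuous_foldKernel hE.1.continuous q).aestronglyMeasurable)
    (Eventually.of_forall fun ξ => ?_)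
  rw [norm_mul, pow_zero, one_mul, mul_comm]
  exact mul_le_mul_of_nonneg_right (norm_foldKernel_le hB q ξ) (norm_nonneg _)

theorem hasFDerivAt_foldKernel {E : ℝ → ℝ} (hE : Differentiable ℝ E) (q : R2)
    (ξ : EuclideanSpace ℝ (Fin 2)) :
    HasFDerivAt (fun q => foldKernel E q ξ)
      (ContinuousLinearMap.smulRightL ℝ R2 ℂ (ContinuousLinearMap.fst ℝ ℝ ℝ)
          ((2 * π * ξ 0 : ℝ) * Complex.I * foldKernel E q ξ) +
        ContinuousLinearMap.smulRightL ℝ R2 ℂ (ContinuousLinearMap.snd ℝ ℝ ℝ)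
          (((2 * π * ξ 1) ^ 2 : ℝ) * foldKernel (deriv E) q ξ)) q := by
  have h1 : HasFDerivAt (fun q : R2 => 2 * π * ξ 0 * q.1)
      ((2 * π * ξ 0) • ContinuousLinearMap.fst ℝ ℝ ℝ) q := hasFDerivAt_fst.const_mul _
  have h2 : HasFDerivAt (fun q : R2 => (2 * π * ξ 1) ^ 2 * q.2)
      ((2 * π * ξ 1) ^ 2 • ContinuousLinearMap.snd ℝ ℝ ℝ) q := hasFDerivAt_snd.const_mul _
  have h3 := ((Complex.ofRealCLM.hasFDerivAt.comp q h1).mul_const Complex.I).cexp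
  have h4 := Complex.ofRealCLM.hasFDerivAt.comp q ((hE _).hasDerivAt.comp_hasFDerivAt q h2)
  refine (h3.mul h4).congr_fderiv ?_
  ext <;> simp [foldKernel] <;> ring

theorem HasIntegrableMoments.contDiff_foldIntegral {h : EuclideanSpace ℝ (Fin 2) → ℂ}
    (hh : HasIntegrableMoments h) {E : ℝ → ℝ} (hE : HasBoundedDerivs E) :
    ContDiff ℝ (⊤ : ℕ∞) (foldIntegral h E) := by
  have hc0 : Continuous fun ξ : EuclideanSpace ℝ (Fin 2) => ((2 * π * ξ 0 : ℝ) * Complex.I) := by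
    fun_prop
  have hc1 : Continuous fun ξ : EuclideanSpace ℝ (Fin 2) => (((2 * π * ξ 1) ^ 2 : ℝ) : ℂ) := by
    fun_prop
  have hb0 : ∀ ξ : EuclideanSpace ℝ (Fin 2),
      ‖((2 * π * ξ 0 : ℝ) * Complex.I)‖ ≤ (2 * π) * ‖ξ‖ ^ 1 := by
    intro ξ
    rw [norm_mul, Complex.norm_I, mul_one, Complex.norm_real, norm_mul, pow_one,
      Real.norm_of_nonneg (by positivity : 0 ≤ 2 * π)]
    gcongr
    exact PiLp.norm_apply_le ξ 0
  have hb1 : ∀ ξ : EuclideanSpace ℝ (Fin 2),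
      ‖(((2 * π * ξ 1) ^ 2 : ℝ) : ℂ)‖ ≤ (2 * π) ^ 2 * ‖ξ‖ ^ 2 := by
    intro ξ
    rw [Complex.norm_real, norm_pow, norm_mul, Real.norm_of_nonneg (by positivity : 0 ≤ 2 * π),
      ← mul_pow]
    gcongr
    exact PiLp.norm_apply_le ξ 1
  have hder : ∀ (h : EuclideanSpace ℝ (Fin 2) → ℂ), HasIntegrableMoments h →
      ∀ (E : ℝ → ℝ), HasBoundedDerivs E → ∀ q, HasFDerivAt (foldIntegral h E)
        (ContinuousLinearMap.smulRightL ℝ R2 ℂ (ContinuousLinearMap.fst ℝ ℝ ℝ)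
            (foldIntegral (fun ξ => h ξ * ((2 * π * ξ 0 : ℝ) * Complex.I)) E q) +
          ContinuousLinearMap.smulRightL ℝ R2 ℂ (ContinuousLinearMap.snd ℝ ℝ ℝ)
            (foldIntegral (fun ξ => h ξ * ((2 * π * ξ 1) ^ 2 : ℝ)) (deriv E) q)) q := by
    intro h hh E hE q
    have hh0 := hh.mul_continuous hc0 hb0
    have hh1 := hh.mul_continuous hc1 hb1
    have i0 := hh0.integrable_mul_foldKernel hE
    have i1 := hh1.integrable_mul_foldKernel hE.deriv
    obtain ⟨B0, hB0⟩ := hE.2 0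
    obtain ⟨B1, hB1⟩ := hE.2 1
    simp only [iteratedDeriv_zero] at hB0
    simp only [iteratedDeriv_one] at hB1
    set L0 := ContinuousLinearMap.smulRightL ℝ R2 ℂ (ContinuousLinearMap.fst ℝ ℝ ℝ) with hL0
    set L1 := ContinuousLinearMap.smulRightL ℝ R2 ℂ (ContinuousLinearMap.snd ℝ ℝ ℝ) with hL1
    have j0 := fun q => L0.integrable_comp (i0 q)
    have j1 := fun q => L1.integrable_comp (i1 q)
    have key := hasFDerivAt_integral_of_dominated_of_fderiv_le
      (μ := MeasureTheory.volume) (F := fun q ξ => h ξ * foldKernel E q ξ)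
      (F' := fun q ξ => L0 (h ξ * ((2 * π * ξ 0 : ℝ) * Complex.I) * foldKernel E q ξ) +
        L1 (h ξ * ((2 * π * ξ 1) ^ 2 : ℝ) * foldKernel (deriv E) q ξ))
      (x₀ := q) (s := Set.univ)
      (bound := fun ξ => ‖L0‖ * (‖h ξ * ((2 * π * ξ 0 : ℝ) * Complex.I)‖ * B0) +
        ‖L1‖ * (‖h ξ * ((2 * π * ξ 1) ^ 2 : ℝ)‖ * B1)) univ_mem
      (Eventually.of_forall fun q =>
        (hh.integrable_mul_foldKernel hE q).aestronglyMeasurable)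
      (hh.integrable_mul_foldKernel hE q)
      ((j0 q).add (j1 q)).aestronglyMeasurable
      (Eventually.of_forall fun ξ q _ => ?_) ?_ (Eventually.of_forall fun ξ q _ => ?_)
    · rw [MeasureTheory.integral_add (j0 q) (j1 q), L0.integral_comp_comm (i0 q),
        L1.integral_comp_comm (i1 q)] at key
      exact key
    · refine (norm_add_le _ _).trans (add_le_add ?_ ?_)
      · refine (L0.le_opNorm _).trans ?_
        rw [norm_mul]
        gcongr
        exact norm_foldKernel_le hB0 q ξ
      · refine (L1.le_opNorm _).trans ?_
        rw [norm_mul]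
        gcongr
        exact norm_foldKernel_le hB1 q ξ
    · have k0 := (hh0.2 0)
      have k1 := (hh1.2 0)
      simp only [pow_zero, one_mul] at k0 k1
      exact ((k0.mul_const B0).const_mul _).add ((k1.mul_const B1).const_mul _)
    · refine ((hasFDerivAt_foldKernel (hE.1.differentiable (by simp)) q ξ).const_mul
        (h ξ)).congr_fderiv ?_
      ext <;> simp [hL0, hL1] <;> ring
  have key : ∀ n : ℕ, ∀ (h : EuclideanSpace ℝ (Fin 2) → ℂ), HasIntegrableMoments h →
      ∀ (E : ℝ → ℝ), HasBoundedDerivs E → ContDiff ℝ n (foldIntegral h E) := by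
    intro n
    induction n with
    | zero =>
      intro h hh E hE
      exact contDiff_zero.2
        (continuous_iff_continuousAt.2 fun x => (hder h hh E hE x).continuousAt)
    | succ n ih =>
      intro h hh E hE
      rw [Nat.cast_succ, contDiff_succ_iff_hasFDerivAt]
      refine ⟨_, ?_, hder h hh E hE⟩
      exact ((ContinuousLinearMap.contDiff _).comp (ih _ (hh.mul_continuous hc0 hb0) E hE)).add
        ((ContinuousLinearMap.contDiff _).comp (ih _ (hh.mul_continuous hc1 hb1) _ hE.deriv))
  exact contDiff_infty.2 fun n => key n h hh E hE

theorem exists_integrableMoments_fourier_eq {F : R2 → ℝ} (hF : ContDiff ℝ (⊤ : ℕ∞) F)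
    (hc : HasCompactSupport F) :
    ∃ h : EuclideanSpace ℝ (Fin 2) → ℂ, HasIntegrableMoments h ∧ ∀ x v : ℝ,
      (F (x, v) : ℂ) = ∫ ξ, Complex.exp ((2 * π * (ξ 0 * x + ξ 1 * v) : ℝ) * Complex.I) * h ξ := by
  let e : EuclideanSpace ℝ (Fin 2) ≃ₜ R2 :=
    (EuclideanSpace.equiv (Fin 2) ℝ).toHomeomorph.trans Homeomorph.finTwoArrow
  let F' : EuclideanSpace ℝ (Fin 2) → ℂ := fun ξ => (F (e ξ) : ℂ)
  have hF' : ContDiff ℝ (⊤ : ℕ∞) F' := by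
    refine Complex.ofRealCLM.contDiff.comp (hF.comp ?_)
    change ContDiff ℝ _ fun ξ : EuclideanSpace ℝ (Fin 2) => (ξ 0, ξ 1)
    fun_prop
  have hc' : HasCompactSupport F' :=
    HasCompactSupport.comp_left (g := fun r : ℝ => (r : ℂ)) (hc.comp_homeomorph e) (by simp)
  let S := hc'.toSchwartzMap hF'
  let h := FourierTransform.fourier S
  refine ⟨h, ⟨h.continuous.aestronglyMeasurable, fun k => h.integrable_pow_mul _ k⟩,
    fun x v => ?_⟩
  have h1 : S = FourierTransformInv.fourierInv h := (FourierTransform.fourierInv_fourier_eq S).symm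
  have h2 : S (!₂[x, v]) = FourierTransformInv.fourierInv (h : EuclideanSpace ℝ (Fin 2) → ℂ)
      (!₂[x, v]) := by
    rw [← SchwartzMap.fourierInv_coe, ← h1]
  rw [Real.fourierInv_eq'] at h2
  have h3 : S (!₂[x, v]) = (F (x, v) : ℂ) := rfl
  rw [← h3, h2]
  congr 1
  ext ξ
  have : inner ℝ ξ (!₂[x, v]) = ξ 0 * x + ξ 1 * v := by
    simp [PiLp.inner_apply, Fin.sum_univ_two]; ring
  rw [this, smul_eq_mul]

/-- Whitney's decomposition into even and odd parts, with a parameter. -/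
theorem exists_contDiff_even_odd {F : R2 → ℝ} (hF : ContDiff ℝ (⊤ : ℕ∞) F)
    (hc : HasCompactSupport F) :
    ∃ G H : R2 → ℝ, ContDiff ℝ (⊤ : ℕ∞) G ∧ ContDiff ℝ (⊤ : ℕ∞) H ∧
      ∀ x v, F (x, v) = G (x, v ^ 2) + v * H (x, v ^ 2) := by
  obtain ⟨h, hh, hFh⟩ := exists_integrableMoments_fourier_eq hF hc
  obtain ⟨E, hE, hcos, hb⟩ := exists_cos_sqrt_extension
  have hEb : HasBoundedDerivs E := ⟨hE, hb⟩
  have hsin : ∀ y, Real.sin y = y * (-2 * deriv E (y ^ 2)) := by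
    intro y
    have h1 : HasDerivAt (fun y => E (y ^ 2)) (deriv E (y ^ 2) * (2 * y)) y := by
      have h0 := ((hE.differentiable (by simp)) (y ^ 2)).hasDerivAt
      have := HasDerivAt.comp (h := fun y : ℝ => y ^ 2) y h0 (hasDerivAt_pow 2 y)
      simpa [Function.comp_def] using this
    have h2 : HasDerivAt (fun y => E (y ^ 2)) (-Real.sin y) y := by
      simp only [hcos]
      exact Real.hasDerivAt_cos y
    linarith [h1.unique h2]
  have hh' : HasIntegrableMoments fun ξ => h ξ * (Complex.I * (-2 * (2 * π * ξ 1) : ℝ)) := by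
    refine hh.mul_continuous (C := 4 * π) (j := 1) (by fun_prop) fun ξ => ?_
    rw [norm_mul, Complex.norm_I, one_mul, Complex.norm_real, pow_one,
      show -2 * (2 * π * ξ 1) = (-(4 * π)) * ξ 1 by ring, norm_mul, norm_neg,
      Real.norm_of_nonneg (by positivity : 0 ≤ 4 * π)]
    gcongr
    exact PiLp.norm_apply_le ξ 1
  refine ⟨fun q => (foldIntegral h E q).re, fun q => (foldIntegral _ (deriv E) q).re,
    Complex.reCLM.contDiff.comp (hh.contDiff_foldIntegral hEb),
    Complex.reCLM.contDiff.comp (hh'.contDiff_foldIntegral hEb.deriv), fun x v => ?_⟩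
  have key : (F (x, v) : ℂ) = foldIntegral h E (x, v ^ 2) +
      v * foldIntegral (fun ξ => h ξ * (Complex.I * (-2 * (2 * π * ξ 1) : ℝ))) (deriv E)
        (x, v ^ 2) := by
    rw [hFh, foldIntegral, foldIntegral, ← MeasureTheory.integral_const_mul,
      ← MeasureTheory.integral_add (hh.integrable_mul_foldKernel hEb _)
        ((hh'.integrable_mul_foldKernel hEb.deriv _).const_mul _)]
    congr 1
    ext ξ
    have e1 : ((2 * π * (ξ 0 * x + ξ 1 * v) : ℝ) : ℂ) * Complex.I =
        (2 * π * ξ 0 * x : ℝ) * Complex.I + (2 * π * ξ 1 * v : ℝ) * Complex.I := by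
      push_cast; ring
    have e2 : Complex.exp ((2 * π * ξ 1 * v : ℝ) * Complex.I) =
        (E ((2 * π * ξ 1) ^ 2 * v ^ 2) : ℝ) +
          (2 * π * ξ 1 * v * (-2 * deriv E ((2 * π * ξ 1) ^ 2 * v ^ 2)) : ℝ) * Complex.I := by
      rw [Complex.exp_mul_I, ← Complex.ofReal_cos, ← Complex.ofReal_sin, ← mul_pow, hcos, ← hsin]
    rw [e1, Complex.exp_add, e2]
    simp only [foldKernel]
    push_cast
    ring
  have := congrArg Complex.re key
  simpa [← Complex.ofReal_mul] using this

theorem isLocalDiffeoAt_of_inverse {E F : Type*} [NormedAddCommGroup E] [NormedSpace ℝ E]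
    [NormedAddCommGroup F] [NormedSpace ℝ F] {Φ : E → F} {Ψ : F → E}
    (hΦ : ContDiff ℝ (⊤ : ℕ∞) Φ) (hΨ : ContDiff ℝ (⊤ : ℕ∞) Ψ) (h1 : ∀ x, Ψ (Φ x) = x)
    (h2 : ∀ y, Φ (Ψ y) = y) (p : E) : IsLocalDiffeoAt Φ p :=
  ⟨Set.univ, Set.univ, Ψ, isOpen_univ, trivial, isOpen_univ, trivial, hΦ.contDiffOn,
    hΨ.contDiffOn, fun _ _ => trivial, fun _ _ => trivial, fun x _ => h1 x, fun y _ => h2 y⟩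

theorem aEquiv_of_target {f1 f2 : R2 → R3} {p : R2} {Ψ : R3 → R3}
    (hΨ : IsLocalDiffeoAt Ψ (f1 p)) (h : ∀ᶠ x in nhds p, Ψ (f1 x) = f2 x) : AEquiv f1 p f2 p :=
  ⟨id, Ψ, isLocalDiffeoAt_of_inverse contDiff_id contDiff_id (fun _ => rfl) (fun _ => rfl) p, rfl,
    hΨ, h.self_of_nhds, h⟩

theorem aEquiv_of_source {f1 f2 : R2 → R3} {p1 p2 : R2} {Φ : R2 → R2}
    (hΦ : IsLocalDiffeoAt Φ p1) (h2 : Φ p1 = p2) (h : ∀ᶠ x in nhds p1, f1 x = f2 (Φ x)) :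
    AEquiv f1 p1 f2 p2 :=
  ⟨Φ, id, hΦ, h2, isLocalDiffeoAt_of_inverse contDiff_id contDiff_id (fun _ => rfl)
    (fun _ => rfl) _, by rw [← h2]; exact h.self_of_nhds, h⟩

theorem hasFDerivAt_mul_of_eq_zero {E : Type*} [NormedAddCommGroup E] [NormedSpace ℝ E]
    {a : E → ℝ} {b : E →L[ℝ] ℝ} (ha : DifferentiableAt ℝ a 0) :
    HasFDerivAt (fun x => a x * b x) (a 0 • b) 0 := by
  refine (ha.hasFDerivAt.mul b.hasFDerivAt).congr_fderiv ?_
  simp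

theorem aEquiv_fCS1p_of_normalForm {Y0 m : ℝ → ℝ} {G l : R2 → ℝ} (hY0 : ContDiff ℝ (⊤ : ℕ∞) Y0)
    (hm : ContDiff ℝ (⊤ : ℕ∞) m) (hG : ContDiff ℝ (⊤ : ℕ∞) G) (hl : ContDiff ℝ (⊤ : ℕ∞) l)
    (hm0 : 0 < m 0) (hl0 : 0 < l (0, 0)) :
    AEquiv (fun q => (q.1, Y0 q.1 + q.2 ^ 2,
      G (q.1, q.2 ^ 2) - q.2 ^ 3 * (q.1 ^ 2 * m q.1 + q.2 ^ 2 * l (q.1, q.2 ^ 2)))) (0, 0)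
      fCS1p (0, 0) := by
  have hm' : ∀ {E : Type} [NormedAddCommGroup E] [NormedSpace ℝ E] {c : E → ℝ},
      ContDiff ℝ (⊤ : ℕ∞) c → ContDiff ℝ (⊤ : ℕ∞) fun x => m (c x) := fun hc => hm.comp hc
  have hl' : ∀ {E : Type} [NormedAddCommGroup E] [NormedSpace ℝ E] {c : E → R2},
      ContDiff ℝ (⊤ : ℕ∞) c → ContDiff ℝ (⊤ : ℕ∞) fun x => l (c x) := fun hc => hl.comp hc
  have hop : ∀ {E : Type} [NormedAddCommGroup E] [NormedSpace ℝ E] {c : E → ℝ},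
      ContDiff ℝ (⊤ : ℕ∞) c → IsOpen {x | 0 < c x} := fun hc =>
    isOpen_lt continuous_const hc.continuous
  have hsq : ∀ {E : Type} [NormedAddCommGroup E] [NormedSpace ℝ E] {c : E → ℝ} {s : Set E},
      ContDiff ℝ (⊤ : ℕ∞) c → (∀ x ∈ s, 0 < c x) →
      ContDiffOn ℝ (⊤ : ℕ∞) (fun x => √(c x)) s := fun hc hs =>
    hc.contDiffOn.sqrt fun x hx => (hs x hx).ne'
  have htop : ((⊤ : ℕ∞) : WithTop ℕ∞) ≠ 0 := by simp
  have hsm : 0 < √(m 0) := Real.sqrt_pos.2 hm0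
  have hsl : 0 < √(l (0, 0)) := Real.sqrt_pos.2 hl0
  have hΨ1 : ∀ q, IsLocalDiffeoAt (fun q : R3 => ((q.1, q.2.1 - Y0 q.1,
      q.2.2 - G (q.1, q.2.1 - Y0 q.1)) : R3)) q := by
    have hY : ContDiff ℝ (⊤ : ℕ∞) fun q : R3 => Y0 q.1 := hY0.comp contDiff_fst
    refine isLocalDiffeoAt_of_inverse
      (Ψ := fun q => (q.1, q.2.1 + Y0 q.1, q.2.2 + G (q.1, q.2.1))) ?_ ?_ ?_ ?_
    · have : ContDiff ℝ (⊤ : ℕ∞) fun q : R3 => G (q.1, q.2.1 - Y0 q.1) :=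
        hG.comp (by fun_prop)
      fun_prop
    · have : ContDiff ℝ (⊤ : ℕ∞) fun q : R3 => G (q.1, q.2.1) := hG.comp (by fun_prop)
      fun_prop
    · intro q; simp
    · intro q; simp
  have hΨ2 : IsLocalDiffeoAt (fun q : R3 => ((√(m q.1) * q.1, l (q.1, q.2.1) * q.2.1,
      -(l (q.1, q.2.1) * √(l (q.1, q.2.1))) * q.2.2) : R3)) (0, 0, 0) := by
    have c1 : ContDiff ℝ (⊤ : ℕ∞) fun q : R3 => m q.1 := hm' (by fun_prop)
    have c2 : ContDiff ℝ (⊤ : ℕ∞) fun q : R3 => l (q.1, q.2.1) := hl' (by fun_prop)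
    have o := (hop c1).inter (hop c2)
    have m0 : ((0, 0, 0) : R3) ∈ {q : R3 | 0 < m q.1} ∩ {q : R3 | 0 < l (q.1, q.2.1)} :=
      ⟨hm0, hl0⟩
    have s1 := hsq c1 (s := {q : R3 | 0 < m q.1} ∩ {q : R3 | 0 < l (q.1, q.2.1)})
      (fun x hx => hx.1)
    have s2 := hsq c2 (s := {q : R3 | 0 < m q.1} ∩ {q : R3 | 0 < l (q.1, q.2.1)})
      (fun x hx => hx.2)
    have c2' := c2.contDiffOn (s := {q : R3 | 0 < m q.1} ∩ {q : R3 | 0 < l (q.1, q.2.1)})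
    refine isLocalDiffeoAt_of_contDiffOn o m0 (by fun_prop) ?_
    have d1 := ((s1.contDiffAt (o.mem_nhds m0)).differentiableAt htop)
    have d2 := ((s2.contDiffAt (o.mem_nhds m0)).differentiableAt htop)
    have d3 : DifferentiableAt ℝ (fun q : R3 => l (q.1, q.2.1)) (0, 0, 0) :=
      c2.contDiffAt.differentiableAt htop
    have k1 := hasFDerivAt_mul_of_eq_zero (b := ContinuousLinearMap.fst ℝ ℝ (ℝ × ℝ)) d1
    have k2 := hasFDerivAt_mul_of_eq_zero
      (b := (ContinuousLinearMap.fst ℝ ℝ ℝ).comp (ContinuousLinearMap.snd ℝ ℝ (ℝ × ℝ))) d3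
    have k3 := hasFDerivAt_mul_of_eq_zero
      (b := (ContinuousLinearMap.snd ℝ ℝ ℝ).comp (ContinuousLinearMap.snd ℝ ℝ (ℝ × ℝ)))
      (d3.mul d2).neg
    have k := (k1.prodMk (k2.prodMk k3)).fderiv
    simp only [Pi.mul_apply, Pi.neg_apply] at k
    change Function.Injective (fderiv ℝ _ (0 : R3))
    refine (injective_iff_map_eq_zero _).2 fun x hx => ?_
    replace hx := (congrArg (fun L : R3 →L[ℝ] R3 => L x) k).symm.trans hx
    simp [hsm.ne', hl0.ne', hsl.ne', Prod.ext_iff] at hx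
    simp [Prod.ext_iff, hx]
  have hΦ : IsLocalDiffeoAt (fun q : R2 => ((√(m q.1) * q.1, √(l (q.1, q.2 ^ 2)) * q.2) : R2))
      (0, 0) := by
    have c1 : ContDiff ℝ (⊤ : ℕ∞) fun q : R2 => m q.1 := hm' (by fun_prop)
    have c2 : ContDiff ℝ (⊤ : ℕ∞) fun q : R2 => l (q.1, q.2 ^ 2) := hl' (by fun_prop)
    have o := (hop c1).inter (hop c2)
    have m0 : ((0, 0) : R2) ∈ {q : R2 | 0 < m q.1} ∩ {q : R2 | 0 < l (q.1, q.2 ^ 2)} :=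
      ⟨hm0, by simpa using hl0⟩
    have s1 := hsq c1 (s := {q : R2 | 0 < m q.1} ∩ {q : R2 | 0 < l (q.1, q.2 ^ 2)})
      (fun x hx => hx.1)
    have s2 := hsq c2 (s := {q : R2 | 0 < m q.1} ∩ {q : R2 | 0 < l (q.1, q.2 ^ 2)})
      (fun x hx => hx.2)
    refine isLocalDiffeoAt_of_contDiffOn o m0 (by fun_prop) ?_
    have d1 := ((s1.contDiffAt (o.mem_nhds m0)).differentiableAt htop)
    have d2 := ((s2.contDiffAt (o.mem_nhds m0)).differentiableAt htop)
    have k1 := hasFDerivAt_mul_of_eq_zero (b := ContinuousLinearMap.fst ℝ ℝ ℝ) d1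
    have k2 := hasFDerivAt_mul_of_eq_zero (b := ContinuousLinearMap.snd ℝ ℝ ℝ) d2
    have k := (k1.prodMk k2).fderiv
    change Function.Injective (fderiv ℝ _ (0 : R2))
    refine (injective_iff_map_eq_zero _).2 fun x hx => ?_
    replace hx := (congrArg (fun L : R2 →L[ℝ] R2 => L x) k).symm.trans hx
    simp [hsm.ne', hsl.ne', Prod.ext_iff] at hx
    simp [Prod.ext_iff, hx]
  refine ⟨_, _, hΦ, by simp, IsLocalDiffeoAt.comp (Φ := fun q : R3 => ((q.1, q.2.1 - Y0 q.1,
      q.2.2 - G (q.1, q.2.1 - Y0 q.1)) : R3)) (by simpa using hΨ2) (hΨ1 _), by simp [fCS1p], ?_⟩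
  have n1 : ∀ᶠ x : R2 in nhds (0, 0), 0 < m x.1 :=
    (hop (hm' contDiff_fst)).mem_nhds hm0
  have n2 : ∀ᶠ x : R2 in nhds (0, 0), 0 < l (x.1, x.2 ^ 2) :=
    (hop (hl' (by fun_prop : ContDiff ℝ (⊤ : ℕ∞) fun x : R2 => (x.1, x.2 ^ 2)))).mem_nhds
      (by simpa using hl0)
  filter_upwards [n1, n2] with x h1 h2
  have e1 := Real.sq_sqrt h1.le
  have e2 := Real.sq_sqrt h2.le
  simp only [Function.comp, fCS1p, Prod.mk.injEq, add_sub_cancel_left]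
  refine ⟨trivial, by rw [mul_pow, e2], ?_⟩
  rw [mul_pow, mul_pow, mul_pow, e1, e2, pow_succ √(l (x.1, x.2 ^ 2)) 2, e2]
  ring

theorem le_zero_of_forall_pos_le {f g : ℝ → ℝ} {δ : ℝ} (hδ : 0 < δ) (hf : Continuous f)
    (hg : Continuous g) (h : ∀ x, 0 < x → x < δ → f x ≤ g x) : f 0 ≤ g 0 := by
  have hev : ∀ᶠ x in nhdsWithin (0 : ℝ) (Set.Ioi 0), f x ≤ g x := by
    filter_upwards [Ioo_mem_nhdsGT hδ] with x hx using h x hx.1 hx.2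
  exact le_of_tendsto_of_tendsto (hf.continuousWithinAt.tendsto) (hg.continuousWithinAt.tendsto) hev

/-- Hadamard's lemma. -/
theorem exists_contDiff_eq_add_mul {f : ℝ → ℝ} (hf : ContDiff ℝ (⊤ : ℕ∞) f) :
    ∃ k, ContDiff ℝ (⊤ : ℕ∞) k ∧ ∀ x, f x = f 0 + x * k x := by
  obtain ⟨K, hK, h⟩ := exists_contDiff_eq_add_snd_mul (F := fun q => f q.2) (hf.comp contDiff_snd)
  exact ⟨fun x => K (0, x), hK.comp (by fun_prop), fun x => h 0 x⟩

theorem aEquiv_fCS1p_of_odd_bounds {Y0 : ℝ → ℝ} {Z : R2 → ℝ} (hY0 : ContDiff ℝ (⊤ : ℕ∞) Y0)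
    (hZ : ContDiff ℝ (⊤ : ℕ∞) Z) (hZc : HasCompactSupport Z) {c C δ : ℝ} (hc : 0 < c)
    (hδ : 0 < δ)
    (h : ∀ x v, |x| < δ → 0 < v → v < δ → c * (x ^ 2 + v ^ 2) * v ^ 3 ≤ Z (x, -v) - Z (x, v) ∧
      Z (x, -v) - Z (x, v) ≤ C * (x ^ 2 + v ^ 2) * v ^ 3) :
    AEquiv (fun q => (q.1, Y0 q.1 + q.2 ^ 2, Z q)) (0, 0) fCS1p (0, 0) := by
  obtain ⟨G, H, hG, hH, hZGH⟩ := exists_contDiff_even_odd hZ hZc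
  have hb : ∀ x w, |x| < δ → 0 < w → w < δ ^ 2 → c * (x ^ 2 + w) * w ≤ -2 * H (x, w) ∧
      -2 * H (x, w) ≤ C * (x ^ 2 + w) * w := by
    intro x w hx hw hwδ
    have hs : 0 < √w := Real.sqrt_pos.2 hw
    obtain ⟨h1, h2⟩ := h x (√w) hx hs ((Real.sqrt_lt' hδ).2 hwδ)
    have e : Z (x, -√w) - Z (x, √w) = -2 * H (x, w) * √w := by
      rw [hZGH, hZGH, neg_sq, Real.sq_sqrt hw.le]; ring
    have e3 : √w ^ 3 = w * √w := by rw [pow_succ, Real.sq_sqrt hw.le]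
    rw [e, e3, Real.sq_sqrt hw.le, ← mul_assoc] at h1 h2
    exact ⟨le_of_mul_le_mul_right h1 hs, le_of_mul_le_mul_right h2 hs⟩
  have hδ2 : 0 < δ ^ 2 := by positivity
  obtain ⟨K, hK, hHK⟩ := exists_contDiff_eq_add_snd_mul hH
  have cH := hH.continuous
  have cK := hK.continuous
  have H0 : ∀ x, |x| < δ → H (x, 0) = 0 := by
    intro x hx
    have h1 := le_zero_of_forall_pos_le (f := fun w => c * (x ^ 2 + w) * w)
      (g := fun w => -2 * H (x, w)) hδ2 (by fun_prop) (by fun_prop) fun w h1 h2 =>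
        (hb x w hx h1 h2).1
    have h2 := le_zero_of_forall_pos_le (f := fun w => -2 * H (x, w))
      (g := fun w => C * (x ^ 2 + w) * w) hδ2 (by fun_prop) (by fun_prop) fun w h1 h2 =>
        (hb x w hx h1 h2).2
    simp only [mul_zero] at h1 h2
    linarith
  have hb' : ∀ x w, |x| < δ → 0 < w → w < δ ^ 2 → c * (x ^ 2 + w) ≤ -2 * K (x, w) ∧
      -2 * K (x, w) ≤ C * (x ^ 2 + w) := by
    intro x w hx hw hwδ
    obtain ⟨h1, h2⟩ := hb x w hx hw hwδ
    rw [hHK, H0 x hx, zero_add, mul_left_comm, mul_comm w] at h1 h2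
    exact ⟨le_of_mul_le_mul_right h1 hw, le_of_mul_le_mul_right h2 hw⟩
  have K0 : ∀ x, |x| < δ → c * x ^ 2 ≤ -2 * K (x, 0) ∧ -2 * K (x, 0) ≤ C * x ^ 2 := by
    intro x hx
    have h1 := le_zero_of_forall_pos_le (f := fun w => c * (x ^ 2 + w))
      (g := fun w => -2 * K (x, w)) hδ2 (by fun_prop) (by fun_prop) fun w h1 h2 =>
        (hb' x w hx h1 h2).1
    have h2 := le_zero_of_forall_pos_le (f := fun w => -2 * K (x, w))
      (g := fun w => C * (x ^ 2 + w)) hδ2 (by fun_prop) (by fun_prop) fun w h1 h2 =>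
        (hb' x w hx h1 h2).2
    simpa using And.intro h1 h2
  obtain ⟨L, hL, hKL⟩ := exists_contDiff_eq_add_snd_mul hK
  have cL := hL.continuous
  have K00 : K (0, 0) = 0 := by
    have := K0 0 (by simpa using hδ)
    norm_num at this
    linarith
  have L0 : c ≤ -2 * L (0, 0) := by
    refine le_zero_of_forall_pos_le (f := fun _ => c) (g := fun w => -2 * L (0, w)) hδ2
      (by fun_prop) (by fun_prop) fun w h1 h2 => ?_
    have := (hb' 0 w (by simpa using hδ) h1 h2).1
    rw [hKL, K00] at this
    refine le_of_mul_le_mul_right (le_of_eq_of_le ?_ (this.trans_eq ?_)) h1 <;> ring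
  obtain ⟨k, hk, hKk⟩ := exists_contDiff_eq_add_mul (f := fun x => K (x, 0))
    (hK.comp (by fun_prop))
  simp only [K00, zero_add] at hKk
  have ck := hk.continuous
  have k0 : k 0 = 0 := by
    have hx : ∀ x, 0 < x → x < δ → c * x ≤ -2 * k x ∧ -2 * k x ≤ C * x := by
      intro x hx hxδ
      obtain ⟨h1, h2⟩ := K0 x (by rwa [abs_of_pos hx])
      rw [hKk] at h1 h2
      exact ⟨le_of_mul_le_mul_right (by linarith) hx, le_of_mul_le_mul_right (by linarith) hx⟩
    have h1 := le_zero_of_forall_pos_le (f := fun x => c * x) (g := fun x => -2 * k x) hδ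
      (by fun_prop) (by fun_prop) fun w h1 h2 => (hx w h1 h2).1
    have h2 := le_zero_of_forall_pos_le (f := fun x => -2 * k x) (g := fun x => C * x) hδ
      (by fun_prop) (by fun_prop) fun w h1 h2 => (hx w h1 h2).2
    simp only [mul_zero] at h1 h2
    linarith
  obtain ⟨m, hm, hkm⟩ := exists_contDiff_eq_add_mul hk
  simp only [k0, zero_add] at hkm
  have cm := hm.continuous
  have m0 : c ≤ -2 * m 0 := by
    refine le_zero_of_forall_pos_le (f := fun _ => c) (g := fun x => -2 * m x) hδ
      (by fun_prop) (by fun_prop) fun x hx hxδ => ?_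
    have h1 := (K0 x (by rwa [abs_of_pos hx])).1
    rw [hKk, hkm] at h1
    exact le_of_mul_le_mul_right (by linarith) (pow_pos hx 2)
  refine (aEquiv_of_source (Φ := id) (isLocalDiffeoAt_of_inverse contDiff_id contDiff_id
    (fun _ => rfl) (fun _ => rfl) _) rfl ?_).trans
    (aEquiv_fCS1p_of_normalForm hY0 hm.neg hG hL.neg (by linarith) (by linarith))
  have : ∀ᶠ q : R2 in nhds (0, 0), |q.1| < δ :=
    (isOpen_lt (by fun_prop) continuous_const).mem_nhds (by simpa using hδ)
  filter_upwards [this] with q hq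
  simp only [id, Prod.mk.injEq, true_and]
  rw [show q = (q.1, q.2) from rfl, hZGH, hHK, H0 _ hq, hKL, hKk, hkm]
  ring

/-- Among all intervals, a quadratic polynomial has the least weighted integral over the interval
between its roots. -/
theorem integral_between_roots_le {w : ℝ → ℝ} (hw : Continuous w) {α β γ δ : ℝ} (hαβ : α ≤ β)
    (hγδ : γ ≤ δ) (h1 : ∀ x ∈ Set.Ioc α β, 0 ≤ w x) (h2 : ∀ x ∈ Set.Ioc γ δ, 0 ≤ w x) :
    ∫ x in α..β, (x - α) * (x - β) * w x ≤ ∫ x in γ..δ, (x - α) * (x - β) * w x := by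
  have hc : Continuous fun x => (x - α) * (x - β) * w x := by fun_prop
  rw [intervalIntegral.integral_of_le hαβ, intervalIntegral.integral_of_le hγδ,
    ← MeasureTheory.integral_indicator measurableSet_Ioc,
    ← MeasureTheory.integral_indicator measurableSet_Ioc]
  refine MeasureTheory.integral_mono
    ((hc.integrableOn_Ioc).integrable_indicator measurableSet_Ioc)
    ((hc.integrableOn_Ioc).integrable_indicator measurableSet_Ioc) fun x => ?_
  by_cases hA : x ∈ Set.Ioc α β <;> by_cases hB : x ∈ Set.Ioc γ δ
  · simp [hA, hB]
  · rw [Set.indicator_of_mem hA, Set.indicator_of_notMem hB]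
    exact mul_nonpos_of_nonpos_of_nonneg
      (mul_nonpos_of_nonneg_of_nonpos (by linarith [hA.1]) (by linarith [hA.2])) (h1 x hA)
  · rw [Set.indicator_of_notMem hA, Set.indicator_of_mem hB]
    refine mul_nonneg ?_ (h2 x hB)
    rw [Set.mem_Ioc, not_and_or, not_lt, not_le] at hA
    rcases hA with hA | hA
    · exact mul_nonneg_of_nonpos_of_nonpos (by linarith) (by linarith)
    · exact mul_nonneg (by linarith) (by linarith)
  · rw [Set.indicator_of_notMem hA, Set.indicator_of_notMem hB]

theorem integral_quadratic_mul {w : ℝ → ℝ} (hw : Continuous w) (α β γ δ : ℝ) :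
    ∫ x in γ..δ, (x - α) * (x - β) * w x = (∫ x in γ..δ, x ^ 2 * w x) -
      (α + β) * (∫ x in γ..δ, x * w x) + α * β * ∫ x in γ..δ, w x := by
  rw [← intervalIntegral.integral_const_mul, ← intervalIntegral.integral_const_mul,
    ← intervalIntegral.integral_sub, ← intervalIntegral.integral_add]
  · congr 1
    ext x
    ring
  all_goals
    refine Continuous.intervalIntegrable ?_ _ _
    fun_prop

theorem integral_quadratic_mul_sq (α β : ℝ) :
    ∫ x in α..β, (x - α) * (x - β) * x ^ 2 =
      -(((α + β) / 2) ^ 2 * (β - α) ^ 3 / 6 + (β - α) ^ 5 / 120) := by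
  have h : ∀ x ∈ Set.uIcc α β, HasDerivAt
      (fun x : ℝ => x ^ 5 / 5 - (α + β) * x ^ 4 / 4 + α * β * x ^ 3 / 3)
      ((x - α) * (x - β) * x ^ 2) x := by
    intro x _
    have := (((hasDerivAt_pow 5 x).div_const 5).sub
      (((hasDerivAt_pow 4 x).const_mul (α + β)).div_const 4)).add
      (((hasDerivAt_pow 3 x).const_mul (α * β)).div_const 3)
    refine this.congr_deriv ?_
    push_cast
    ring
  rw [intervalIntegral.integral_eq_sub_of_hasDerivAt h
    (Continuous.intervalIntegrable (by fun_prop) _ _)]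
  ring

theorem second_moment_diff_bounds {a b : ℝ → ℝ} (ha : Continuous a) (hb : Continuous b)
    {k1 k2 r : ℝ} (hk2 : 0 ≤ k2) (hab : ∀ x, |x| ≤ r → 0 ≤ a x ∧ 0 ≤ b x ∧
      k1 * x ^ 2 ≤ a x - b x ∧ a x - b x ≤ k2 * x ^ 2)
    {s s' t t' R : ℝ} (hs : |s| ≤ r) (hs' : |s'| ≤ r) (ht : |t| ≤ r) (ht' : |t'| ≤ r)
    (hss : s' ≤ s) (htt : t ≤ t') (htR : |t| ≤ R) (htR' : |t'| ≤ R)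
    (h0 : ∫ x in s'..s, a x = ∫ x in t..t', b x)
    (h1 : ∫ x in s'..s, x * a x = ∫ x in t..t', x * b x) :
    k1 * (((s' + s) / 2) ^ 2 * (s - s') ^ 3 / 6 + (s - s') ^ 5 / 120) ≤
      (∫ x in t..t', x ^ 2 * b x) - (∫ x in s'..s, x ^ 2 * a x) ∧
    (∫ x in t..t', x ^ 2 * b x) - (∫ x in s'..s, x ^ 2 * a x) ≤ k2 * R ^ 2 * (t' - t) ^ 3 := by
  have hA : ∀ x ∈ Set.Icc s' s, |x| ≤ r := fun x hx =>
    abs_le.2 ⟨by linarith [(abs_le.1 hs').1, hx.1], by linarith [(abs_le.1 hs).2, hx.2]⟩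
  have hB : ∀ x ∈ Set.Icc t t', |x| ≤ r := fun x hx =>
    abs_le.2 ⟨by linarith [(abs_le.1 ht).1, hx.1], by linarith [(abs_le.1 ht').2, hx.2]⟩
  have hBR : ∀ x ∈ Set.Icc t t', |x| ≤ R := fun x hx =>
    abs_le.2 ⟨by linarith [(abs_le.1 htR).1, hx.1], by linarith [(abs_le.1 htR').2, hx.2]⟩
  have key : ∀ α β, (∫ x in t..t', x ^ 2 * b x) - (∫ x in s'..s, x ^ 2 * a x) =
      (∫ x in t..t', (x - α) * (x - β) * b x) - ∫ x in s'..s, (x - α) * (x - β) * a x := by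
    intro α β
    rw [integral_quadratic_mul hb, integral_quadratic_mul ha, h0, h1]
    ring
  have hii : ∀ {g : ℝ → ℝ} {x y : ℝ}, Continuous g →
      IntervalIntegrable g MeasureTheory.volume x y := fun hg => hg.intervalIntegrable _ _
  constructor
  · rw [key s' s]
    have c1 := integral_between_roots_le hb hss htt
      (fun x hx => (hab x (hA x (Set.Ioc_subset_Icc_self hx))).2.1)
      (fun x hx => (hab x (hB x (Set.Ioc_subset_Icc_self hx))).2.1)
    have c2 : ∫ x in s'..s, (x - s') * (x - s) * a x ≤
        ∫ x in s'..s, ((x - s') * (x - s) * b x + k1 * ((x - s') * (x - s) * x ^ 2)) := by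
      refine intervalIntegral.integral_mono_on hss (hii (by fun_prop)) (hii (by fun_prop))
        fun x hx => ?_
      have := (hab x (hA x hx)).2.2.1
      nlinarith [mul_nonneg (sub_nonneg.2 hx.1) (sub_nonneg.2 hx.2)]
    rw [intervalIntegral.integral_add (hii (by fun_prop)) (hii (by fun_prop)),
      intervalIntegral.integral_const_mul, integral_quadratic_mul_sq] at c2
    linarith
  · rw [key t t']
    have c1 := integral_between_roots_le ha htt hss
      (fun x hx => (hab x (hB x (Set.Ioc_subset_Icc_self hx))).1)
      (fun x hx => (hab x (hA x (Set.Ioc_subset_Icc_self hx))).1)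
    have c2 : ∫ x in t..t', (x - t) * (x - t') * b x ≤
        ∫ x in t..t', ((x - t) * (x - t') * a x + k2 * R ^ 2 * (t' - t) ^ 2) := by
      refine intervalIntegral.integral_mono_on htt (hii (by fun_prop)) (hii (by fun_prop))
        fun x hx => ?_
      have h3 := (hab x (hB x hx)).2.2.2
      have h4 : x ^ 2 ≤ R ^ 2 := by
        rw [← sq_abs x]; gcongr; exact hBR x hx
      have h5 : (x - t) * (t' - x) ≤ (t' - t) ^ 2 := by
        nlinarith [sub_nonneg.2 hx.1, sub_nonneg.2 hx.2]
      have h6 : 0 ≤ (x - t) * (t' - x) := mul_nonneg (sub_nonneg.2 hx.1) (sub_nonneg.2 hx.2)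
      have h7 : (x - t) * (t' - x) * (a x - b x) ≤ (t' - t) ^ 2 * (k2 * R ^ 2) :=
        calc (x - t) * (t' - x) * (a x - b x) ≤ (x - t) * (t' - x) * (k2 * R ^ 2) := by
              refine mul_le_mul_of_nonneg_left (h3.trans ?_) h6
              gcongr
          _ ≤ _ := by gcongr
      nlinarith
    rw [intervalIntegral.integral_add (hii (by fun_prop)) (hii (by fun_prop)),
      intervalIntegral.integral_const, smul_eq_mul] at c2
    nlinarith

/-- The primitive of `x ^ i * a x` that vanishes at the origin. -/
def moment (i : ℕ) (a : ℝ → ℝ) (s : ℝ) : ℝ := ∫ x in 0..s, x ^ i * a x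

theorem hasDerivAt_moment {a : ℝ → ℝ} (ha : Continuous a) (i : ℕ) (s : ℝ) :
    HasDerivAt (moment i a) (s ^ i * a s) s := by
  have hc : Continuous fun x => x ^ i * a x := by fun_prop
  exact hc.integral_hasStrictDerivAt 0 s |>.hasDerivAt

theorem contDiff_moment {a : ℝ → ℝ} (ha : ContDiff ℝ (⊤ : ℕ∞) a) (i : ℕ) :
    ContDiff ℝ (⊤ : ℕ∞) (moment i a) := by
  have h := hasDerivAt_moment ha.continuous i
  refine contDiff_infty_iff_deriv.2 ⟨fun s => (h s).differentiableAt, ?_⟩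
  rw [show deriv (moment i a) = fun s => s ^ i * a s from funext fun s => (h s).deriv]
  fun_prop

theorem moment_zero (i : ℕ) (a : ℝ → ℝ) : moment i a 0 = 0 := by simp [moment]

theorem moment_sub {a : ℝ → ℝ} (ha : Continuous a) (i : ℕ) (s s' : ℝ) :
    moment i a s - moment i a s' = ∫ x in s'..s, x ^ i * a x := by
  have hc : Continuous fun x => x ^ i * a x := by fun_prop
  exact intervalIntegral.integral_interval_sub_left (hc.intervalIntegrable _ _)
    (hc.intervalIntegrable _ _)

/-- The sum of the `i`-th moments of two densities. -/
def momentSum (i : ℕ) (a b : ℝ → ℝ) (q : R2) : ℝ := moment i a q.1 + moment i b q.2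

theorem contDiff_momentSum {a b : ℝ → ℝ} (ha : ContDiff ℝ (⊤ : ℕ∞) a)
    (hb : ContDiff ℝ (⊤ : ℕ∞) b) (i : ℕ) : ContDiff ℝ (⊤ : ℕ∞) (momentSum i a b) :=
  ((contDiff_moment ha i).comp contDiff_fst).add ((contDiff_moment hb i).comp contDiff_snd)

theorem hasFDerivAt_momentSum {a b : ℝ → ℝ} (ha : Continuous a) (hb : Continuous b) (i : ℕ)
    (q : R2) : HasFDerivAt (momentSum i a b)
      ((q.1 ^ i * a q.1) • ContinuousLinearMap.fst ℝ ℝ ℝ +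
        (q.2 ^ i * b q.2) • ContinuousLinearMap.snd ℝ ℝ ℝ) q :=
  ((hasDerivAt_moment ha i q.1).comp_hasFDerivAt q hasFDerivAt_fst).add
    ((hasDerivAt_moment hb i q.2).comp_hasFDerivAt q hasFDerivAt_snd)

theorem isLocalDiffeoAt_momentSum_sub {a b : ℝ → ℝ} (ha : ContDiff ℝ (⊤ : ℕ∞) a)
    (hb : ContDiff ℝ (⊤ : ℕ∞) b) (ha0 : 0 < a 0) (hb0 : 0 < b 0) :
    IsLocalDiffeoAt (fun q : R2 => ((momentSum 0 a b q, q.1 - q.2) : R2)) 0 := by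
  refine isLocalDiffeoAt_of_contDiffOn isOpen_univ trivial
    (((contDiff_momentSum ha hb 0).prodMk (by fun_prop)).contDiffOn) ?_
  have k := ((hasFDerivAt_momentSum ha.continuous hb.continuous 0 0).prodMk
    ((hasFDerivAt_fst (𝕜 := ℝ) (p := (0 : R2))).sub hasFDerivAt_snd)).fderiv
  refine (injective_iff_map_eq_zero _).2 fun x hx => ?_
  replace hx := (congrArg (fun L : R2 →L[ℝ] R2 => L x) k).symm.trans hx
  simp [Prod.ext_iff] at hx
  obtain ⟨h1, h2⟩ := hx
  have h3 : x.2 = x.1 := by linarith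
  rw [h3] at h1
  have h4 : x.1 = 0 := by
    have : (a 0 + b 0) * x.1 = 0 := by linarith
    exact (mul_eq_zero.1 this).resolve_left (by positivity)
  exact Prod.ext h4 (h3.trans h4)

/-- Along a level curve of the zeroth moment the first moment has derivative
`(s - t) a b / (a + b)` with respect to `s - t`. -/
theorem hasDerivAt_momentSum_one_comp {a b : ℝ → ℝ} (ha : Continuous a) (hb : Continuous b)
    {i : R2 → R2} {z : R2} (hi : DifferentiableAt ℝ i z)
    (hinv : ∀ᶠ z in nhds z, ((momentSum 0 a b (i z), (i z).1 - (i z).2) : R2) = z)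
    (hab : a (i z).1 + b (i z).2 ≠ 0) :
    HasDerivAt (fun y => momentSum 1 a b (i (z.1, y)))
      (z.2 * (a (i z).1 * b (i z).2 / (a (i z).1 + b (i z).2))) z.2 := by
  have hc : HasDerivAt (fun y : ℝ => ((z.1, y) : R2)) (0, 1) z.2 :=
    (hasDerivAt_const _ _).prodMk (hasDerivAt_id _)
  have hci : HasDerivAt (fun y => i (z.1, y)) (fderiv ℝ i z (0, 1)) z.2 :=
    HasFDerivAt.comp_hasDerivAt z.2 (l := i) (f := fun y : ℝ => ((z.1, y) : R2))
      hi.hasFDerivAt hc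
  set w := fderiv ℝ i z (0, 1) with hw
  have hm : ∀ j, HasDerivAt (fun y => momentSum j a b (i (z.1, y)))
      ((i z).1 ^ j * a (i z).1 * w.1 + (i z).2 ^ j * b (i z).2 * w.2) z.2 := fun j =>
    HasFDerivAt.comp_hasDerivAt z.2 (l := momentSum j a b) (f := fun y : ℝ => i (z.1, y))
      (hasFDerivAt_momentSum ha hb j _) hci
  have hev : ∀ᶠ y in nhds z.2, ((momentSum 0 a b (i (z.1, y)),
      (i (z.1, y)).1 - (i (z.1, y)).2) : R2) = (z.1, y) :=
    (hc.continuousAt.tendsto : Tendsto _ _ (nhds z)).eventually hinv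
  have e0 := (hm 0).unique ((hasDerivAt_const z.2 z.1).congr_of_eventuallyEq
    (hev.mono fun y hy => congrArg Prod.fst hy))
  have hsub : HasDerivAt (fun y => (i (z.1, y)).1 - (i (z.1, y)).2) (w.1 - w.2) z.2 :=
    (hasFDerivAt_fst.comp_hasDerivAt z.2 hci).sub (hasFDerivAt_snd.comp_hasDerivAt z.2 hci)
  have e1 := hsub.unique ((hasDerivAt_id z.2).congr_of_eventuallyEq
    (hev.mono fun y hy => congrArg Prod.snd hy))
  have e2 : (i z).1 - (i z).2 = z.2 := congrArg Prod.snd hinv.self_of_nhds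
  refine (hm 1).congr_deriv ?_
  simp only [pow_zero, one_mul] at e0
  have w1 : w.1 = b (i z).2 / (a (i z).1 + b (i z).2) := by
    rw [eq_div_iff hab]; linear_combination e0 + b (i z).2 * e1
  have w2 : w.2 = -a (i z).1 / (a (i z).1 + b (i z).2) := by
    rw [eq_div_iff hab]; linear_combination e0 - a (i z).1 * e1
  rw [w1, w2, ← e2]
  field_simp
  ring

/-- A parametrized Morse lemma. -/
theorem exists_parametrized_morse {Y : R2 → ℝ} (hY : ContDiff ℝ (⊤ : ℕ∞) Y) {E : R2 → ℝ}
    {e δ : ℝ} (he : 0 < e) (hδ : 0 < δ)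
    (hE : ∀ x y, |x| < δ → |y| < δ → HasDerivAt (fun y => Y (x, y)) (y * E (x, y)) y ∧
      e ≤ E (x, y)) :
    ∃ Γ : R2 → R2, IsLocalDiffeoAt Γ 0 ∧ Γ 0 = 0 ∧ ∃ Y0 : ℝ → ℝ, ContDiff ℝ (⊤ : ℕ∞) Y0 ∧
      ∀ᶠ q in nhds 0, (Γ q).1 = q.1 ∧ Y q = Y0 q.1 + (Γ q).2 ^ 2 ∧
        (0 < (Γ q).2 → 0 < q.2) ∧ ((Γ q).2 < 0 → q.2 < 0) := by
  obtain ⟨K, hK, hYK⟩ := exists_contDiff_eq_add_snd_mul hY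
  have K0 : ∀ x, |x| < δ → K (x, 0) = 0 := by
    intro x hx
    have h1 := (hE x 0 hx (by simpa using hδ)).1
    have hKd : DifferentiableAt ℝ (fun y => K (x, y)) 0 :=
      (hK.comp (by fun_prop : ContDiff ℝ (⊤ : ℕ∞) fun y : ℝ => ((x, y) : R2))).contDiffAt
        |>.differentiableAt (by simp)
    have h2 := ((hasDerivAt_id (0 : ℝ)).mul hKd.hasDerivAt).const_add (Y (x, 0))
    have h3 : (fun y => Y (x, y)) = fun y => Y (x, 0) + id y * K (x, y) :=
      funext fun y => hYK x y
    rw [h3] at h1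
    simpa using h2.unique h1
  obtain ⟨M, hM, hKM⟩ := exists_contDiff_eq_add_snd_mul hK
  have hYM : ∀ x y, |x| < δ → Y (x, y) = Y (x, 0) + y ^ 2 * M (x, y) := by
    intro x y hx
    rw [hYK, hKM, K0 x hx]; ring
  have cM := hM.continuous
  have M0 : e / 2 ≤ M (0, 0) := by
    refine le_zero_of_forall_pos_le (f := fun _ => e / 2) (g := fun y => M (0, y)) hδ
      continuous_const (by fun_prop) fun y hy hyδ => ?_
    have hd : ∀ z, |z| < δ → HasDerivAt (fun y => Y (0, y) - e / 2 * y ^ 2)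
        (z * E (0, z) - e / 2 * (2 * z)) z := fun z hz =>
      ((hE 0 z (by simpa using hδ) hz).1.sub ((hasDerivAt_pow 2 z).const_mul (e / 2))).congr_deriv
        (by simp)
    have habs : ∀ z ∈ Set.Icc 0 y, |z| < δ := fun z hz => by
      rw [abs_of_nonneg hz.1]; linarith [hz.2]
    have hmono : MonotoneOn (fun y => Y (0, y) - e / 2 * y ^ 2) (Set.Icc 0 y) := by
      refine monotoneOn_of_hasDerivWithinAt_nonneg (convex_Icc 0 y)
        (fun z hz => (hd z (habs z hz)).continuousAt.continuousWithinAt)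
        (fun z hz => (hd z (habs z (interior_subset hz))).hasDerivWithinAt) fun z hz => ?_
      have h1 := (hE 0 z (by simpa using hδ) (habs z (interior_subset hz))).2
      have h2 : 0 ≤ z := (interior_subset hz).1
      nlinarith
    have := hmono (Set.left_mem_Icc.2 hy.le) (Set.right_mem_Icc.2 hy.le) hy.le
    simp only at this
    rw [hYM 0 y (by simpa using hδ)] at this
    refine le_of_mul_le_mul_right (a := y ^ 2) ?_ (by positivity)
    linarith
  have hM0 : 0 < M 0 := lt_of_lt_of_le (by positivity) M0
  have hop : IsOpen {q | 0 < M q} := isOpen_lt continuous_const cM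
  have hsq : ContDiffOn ℝ (⊤ : ℕ∞) (fun q => √(M q)) {q | 0 < M q} :=
    hM.contDiffOn.sqrt fun q hq => ne_of_gt hq
  refine ⟨fun q => (q.1, √(M q) * q.2), ?_, by simp, fun x => Y (x, 0), hY.comp (by fun_prop), ?_⟩
  · refine isLocalDiffeoAt_of_contDiffOn hop hM0
      (contDiffOn_fst.prodMk (hsq.mul contDiffOn_snd)) ?_
    have k := ((hasFDerivAt_fst (𝕜 := ℝ) (p := (0 : R2))).prodMk
      (hasFDerivAt_mul_of_eq_zero (b := ContinuousLinearMap.snd ℝ ℝ ℝ)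
        ((hsq.contDiffAt (hop.mem_nhds hM0)).differentiableAt (by simp)))).fderiv
    refine (injective_iff_map_eq_zero _).2 fun x hx => ?_
    replace hx := (congrArg (fun L : R2 →L[ℝ] R2 => L x) k).symm.trans hx
    simp [(Real.sqrt_pos.2 hM0).ne', Prod.ext_iff] at hx
    simp [Prod.ext_iff, hx]
  · have : ∀ᶠ q : R2 in nhds 0, |q.1| < δ :=
      (isOpen_lt (by fun_prop) continuous_const).mem_nhds (by simpa using hδ)
    filter_upwards [this, hop.mem_nhds hM0] with q hq hMq
    have hs := Real.sqrt_pos.2 hMq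
    refine ⟨rfl, ?_, fun h => pos_of_mul_pos_right h hs.le,
      fun h => neg_of_mul_neg_right h hs.le⟩
    rw [mul_pow, Real.sq_sqrt (le_of_lt hMq)]
    exact (hYM q.1 q.2 hq).trans (by ring)

theorem exists_forall_abs_lt_of_eventually {P : R2 → Prop} (h : ∀ᶠ q in nhds 0, P q) :
    ∃ δ > 0, ∀ x y, |x| < δ → |y| < δ → P (x, y) := by
  obtain ⟨δ, hδ, h⟩ := Metric.eventually_nhds_iff.1 h
  exact ⟨δ, hδ, fun x y hx hy => h (by simpa [Prod.dist_eq] using ⟨hx, hy⟩)⟩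

theorem exists_fold_coordinates {a b : ℝ → ℝ} (ha : ContDiff ℝ (⊤ : ℕ∞) a)
    (hb : ContDiff ℝ (⊤ : ℕ∞) b) (ha0 : 0 < a 0) (hb0 : 0 < b 0) :
    ∃ Φ : R2 → R2, IsLocalDiffeoAt Φ 0 ∧ Φ 0 = 0 ∧ ∃ Y0 : ℝ → ℝ, ContDiff ℝ (⊤ : ℕ∞) Y0 ∧
      ∀ᶠ q in nhds 0, (Φ q).1 = momentSum 0 a b q ∧
        momentSum 1 a b q = Y0 (Φ q).1 + (Φ q).2 ^ 2 ∧
        (0 < (Φ q).2 → q.2 < q.1) ∧ ((Φ q).2 < 0 → q.1 < q.2) := by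
  have hΘ := isLocalDiffeoAt_momentSum_sub ha hb ha0 hb0
  set Θ : R2 → R2 := fun q => (momentSum 0 a b q, q.1 - q.2) with hΘdef
  have hΘ0 : Θ 0 = 0 := by simp [hΘdef, momentSum, moment_zero]
  have hΘc : Continuous Θ := by
    have := (contDiff_momentSum ha hb 0).continuous
    fun_prop
  obtain ⟨U, V, i, hU, h0U, hV, h0V, -, hi, -, -, hl, hr⟩ := id hΘ
  rw [hΘ0] at h0V
  have hVn : V ∈ nhds (0 : R2) := hV.mem_nhds h0V
  have hi0 : i 0 = 0 := by simpa [hΘ0] using hl 0 h0U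
  obtain ⟨Y, hY, -, hYe⟩ := exists_contDiff_eventuallyEq hV h0V
    ((contDiff_momentSum ha hb 1).comp_contDiffOn hi)
  have hic : ContinuousAt i 0 := hi.continuousOn.continuousAt hVn
  have hac : ContinuousAt (fun z => a (i z).1) 0 :=
    (ha.continuous.continuousAt).comp (f := fun z => (i z).1) hic.fst
  have hbc : ContinuousAt (fun z => b (i z).2) 0 :=
    (hb.continuous.continuousAt).comp (f := fun z => (i z).2) hic.snd
  have ha0' : 0 < a (i 0).1 := by rw [hi0]; exact ha0
  have hb0' : 0 < b (i 0).2 := by rw [hi0]; exact hb0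
  have hEc : ContinuousAt (fun z => a (i z).1 * b (i z).2 / (a (i z).1 + b (i z).2)) 0 :=
    (hac.mul hbc).div (hac.add hbc) (by positivity)
  have hE0 : 0 < a (i 0).1 * b (i 0).2 / (a (i 0).1 + b (i 0).2) := by positivity
  obtain ⟨e, he, heE⟩ := exists_between hE0
  have hev : ∀ᶠ z in nhds (0 : R2), HasDerivAt (fun y => Y (z.1, y))
      (z.2 * (a (i z).1 * b (i z).2 / (a (i z).1 + b (i z).2))) z.2 ∧
      e ≤ a (i z).1 * b (i z).2 / (a (i z).1 + b (i z).2) := by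
    filter_upwards [hYe.eventuallyEq_nhds, hVn, hac.eventually (lt_mem_nhds ha0'),
      hbc.eventually (lt_mem_nhds hb0'), hEc.eventually (lt_mem_nhds heE)] with z h1 h2 h3 h4 h5
    refine ⟨?_, h5.le⟩
    refine (hasDerivAt_momentSum_one_comp ha.continuous hb.continuous
      ((hi.contDiffAt (hV.mem_nhds h2)).differentiableAt (by simp))
      (by filter_upwards [hV.mem_nhds h2] with z hz using hr z hz)
      (by positivity)).congr_of_eventuallyEq ?_
    have hc : ContinuousAt (fun y : ℝ => ((z.1, y) : R2)) z.2 := by fun_prop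
    exact hc.tendsto.eventually (p := fun q => Y q = momentSum 1 a b (i q)) h1
  obtain ⟨δ, hδ, hδE⟩ := exists_forall_abs_lt_of_eventually hev
  obtain ⟨Γ, hΓ, hΓ0, Y0, hY0, hΓe⟩ := exists_parametrized_morse hY
    (E := fun z => a (i z).1 * b (i z).2 / (a (i z).1 + b (i z).2)) he hδ hδE
  refine ⟨Γ ∘ Θ, IsLocalDiffeoAt.comp (by rwa [hΘ0]) hΘ, by simp [hΘ0, hΓ0], Y0, hY0, ?_⟩
  have ht : Tendsto Θ (nhds 0) (nhds 0) := by
    have := hΘc.tendsto 0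
    rwa [hΘ0] at this
  filter_upwards [ht.eventually hΓe, ht.eventually hYe, hU.mem_nhds h0U]
    with q ⟨h1, h2, h3, h4⟩ h5 h6
  simp only [Function.comp] at h5 ⊢
  rw [hl q h6] at h5
  refine ⟨h1, by rw [h1, ← h2, h5], fun h => ?_, fun h => ?_⟩
  · simpa [hΘdef] using h3 h
  · simpa [hΘdef] using h4 h

theorem sq_add_sq_le {K M x v m L : ℝ} (hM : 0 < M)
    (hx : |x| ≤ K * (|m| + (M + 1) * L)) (hv : v ≤ K * ((M + 1) * L)) (hv0 : 0 ≤ v) :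
    x ^ 2 + v ^ 2 ≤ 4 * K ^ 2 * (M + 1) ^ 2 * (m ^ 2 + L ^ 2) := by
  have f1 : x ^ 2 ≤ (K * (|m| + (M + 1) * L)) ^ 2 := by
    rw [← sq_abs x]; exact pow_le_pow_left₀ (abs_nonneg x) hx 2
  have f2 : v ^ 2 ≤ (K * ((M + 1) * L)) ^ 2 := pow_le_pow_left₀ hv0 hv 2
  have f3 : (|m| + (M + 1) * L) ^ 2 ≤ 2 * m ^ 2 + 2 * ((M + 1) * L) ^ 2 := by
    rw [← sq_abs m]; nlinarith only [sq_nonneg (|m| - (M + 1) * L)]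
  have f4 : m ^ 2 ≤ (M + 1) ^ 2 * m ^ 2 :=
    le_mul_of_one_le_left (sq_nonneg m) (one_le_pow₀ (by linarith))
  have f5 : (|m| + (M + 1) * L) ^ 2 + ((M + 1) * L) ^ 2 ≤
      4 * (M + 1) ^ 2 * (m ^ 2 + L ^ 2) := by
    nlinarith only [f3, f4, sq_nonneg m, sq_nonneg ((M + 1) * L)]
  rw [mul_pow] at f1 f2
  nlinarith only [f1, f2, mul_le_mul_of_nonneg_left f5 (sq_nonneg K)]

theorem two_point_lower_bound {K M k x v s s' t t' : ℝ} (hK : 0 < K) (hM : 0 < M) (hk : 0 < k)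
    (hv : 0 < v) (hss : s' < s) (htt : t < t') (hts : t < s) (hst : s' < t')
    (hM' : t' - t ≤ M * (s - s')) (hx : |x| ≤ K * max |s| |t|)
    (h2v : 2 * v ≤ K * max |s - s'| |t - t'|) :
    k * (2 / (K * (M + 1))) ^ 3 / (480 * K ^ 2 * (M + 1) ^ 2) * (x ^ 2 + v ^ 2) * v ^ 3 ≤
      k * (((s' + s) / 2) ^ 2 * (s - s') ^ 3 / 6 + (s - s') ^ 5 / 120) := by
  obtain ⟨L, hL⟩ : ∃ L, L = s - s' := ⟨_, rfl⟩
  obtain ⟨m, hm⟩ : ∃ m, m = (s' + s) / 2 := ⟨_, rfl⟩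
  have hs : s = m + L / 2 := by rw [hm, hL]; ring
  have hs' : s' = m - L / 2 := by rw [hm, hL]; ring
  have hL0 : 0 < L := by rw [hL]; linarith
  have hML : 0 < M * L := by positivity
  rw [← hm, ← hL]
  rw [← hL] at hM'
  have e1 : max |s - s'| |t - t'| ≤ (M + 1) * L := by
    refine max_le (abs_le.2 ⟨?_, ?_⟩) (abs_le.2 ⟨?_, ?_⟩) <;> nlinarith
  have e2 : 2 * v ≤ K * ((M + 1) * L) := h2v.trans (by gcongr)
  have e3 : max |s| |t| ≤ |m| + (M + 1) * L := by
    have := abs_le.1 (le_refl |m|)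
    refine max_le (abs_le.2 ⟨?_, ?_⟩) (abs_le.2 ⟨?_, ?_⟩) <;> nlinarith
  have e4 : |x| ≤ K * (|m| + (M + 1) * L) := hx.trans (by gcongr)
  have e5 : x ^ 2 + v ^ 2 ≤ 4 * K ^ 2 * (M + 1) ^ 2 * (m ^ 2 + L ^ 2) := by
    exact sq_add_sq_le hM e4 (by linarith) hv.le
  have e6 : 2 / (K * (M + 1)) * v ≤ L := by
    rw [div_mul_eq_mul_div, div_le_iff₀ (by positivity)]; linarith
  calc k * (2 / (K * (M + 1))) ^ 3 / (480 * K ^ 2 * (M + 1) ^ 2) * (x ^ 2 + v ^ 2) * v ^ 3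
      = k / (480 * K ^ 2 * (M + 1) ^ 2) * (x ^ 2 + v ^ 2) * (2 / (K * (M + 1)) * v) ^ 3 := by ring
    _ ≤ k / (480 * K ^ 2 * (M + 1) ^ 2) * (4 * K ^ 2 * (M + 1) ^ 2 * (m ^ 2 + L ^ 2)) *
        L ^ 3 := by gcongr
    _ = k * ((m ^ 2 + L ^ 2) * L ^ 3 / 120) := by field_simp; ring
    _ ≤ _ := by
      gcongr
      nlinarith [mul_nonneg (sq_nonneg m) (pow_nonneg hL0.le 3)]

theorem two_point_upper_bound {K k x v t t' : ℝ} (hK : 0 < K) (hk : 0 ≤ k) (hv : 0 < v)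
    (htt : t < t') (h : |t - t'| ≤ K * (2 * v)) :
    k * (K * max |x| |v|) ^ 2 * (t' - t) ^ 3 ≤ 8 * k * K ^ 5 * (x ^ 2 + v ^ 2) * v ^ 3 := by
  have h1 : t' - t ≤ K * (2 * v) := by linarith [neg_le_abs (t - t')]
  have h2 : max |x| |v| ^ 2 ≤ x ^ 2 + v ^ 2 := by
    rcases max_choice |x| |v| with h | h <;> rw [h, sq_abs]
    · linarith [sq_nonneg v]
    · linarith [sq_nonneg x]
  have h3 : 0 ≤ t' - t := by linarith
  calc k * (K * max |x| |v|) ^ 2 * (t' - t) ^ 3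
      ≤ k * (K ^ 2 * (x ^ 2 + v ^ 2)) * (K * (2 * v)) ^ 3 := by
        rw [mul_pow]; gcongr
    _ = _ := by ring

theorem IsLocalDiffeoAt.exists_inverse_lipschitz {Φ : R2 → R2} (hΦ : IsLocalDiffeoAt Φ 0)
    (h0 : Φ 0 = 0) : ∃ (V : Set R2) (i : R2 → R2) (K : ℝ), 0 < K ∧ IsOpen V ∧ (0 : R2) ∈ V ∧
      ContDiffOn ℝ (⊤ : ℕ∞) i V ∧ i 0 = 0 ∧ (∀ z ∈ V, Φ (i z) = z) ∧
      (∀ᶠ q in nhds 0, i (Φ q) = q) ∧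
      ∀ z ∈ V, ∀ z' ∈ V, ‖i z - i z'‖ ≤ K * ‖z - z'‖ ∧ ‖z - z'‖ ≤ K * ‖i z - i z'‖ := by
  obtain ⟨U, V, i, hU, h0U, hV, h0V, hΦU, hi, -, -, hl, hr⟩ := hΦ
  rw [h0] at h0V
  have hi0 : i 0 = 0 := by simpa [h0] using hl 0 h0U
  have hVn : V ∈ nhds (0 : R2) := hV.mem_nhds h0V
  obtain ⟨K1, s1, hs1, hL1⟩ := ((hi.contDiffAt hVn).of_le
    (by simp : (1 : WithTop ℕ∞) ≤ (⊤ : ℕ∞))).exists_lipschitzOnWith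
  obtain ⟨K2, s2, hs2, hL2⟩ := ((hΦU.contDiffAt (hU.mem_nhds h0U)).of_le
    (by simp : (1 : WithTop ℕ∞) ≤ (⊤ : ℕ∞))).exists_lipschitzOnWith
  have hic : Tendsto i (nhds 0) (nhds 0) := by
    have := (hi.continuousOn.continuousAt hVn).tendsto
    rwa [hi0] at this
  have hmem : V ∩ s1 ∩ i ⁻¹' s2 ∈ nhds (0 : R2) := inter_mem (inter_mem hVn hs1) (hic hs2)
  obtain ⟨W, hWs, hW, h0W⟩ := mem_nhds_iff.1 hmem
  refine ⟨W, i, max (K1 : ℝ) K2 + 1, by positivity, hW, h0W, hi.mono fun z hz => (hWs hz).1.1, hi0,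
    fun z hz => hr z (hWs hz).1.1, ?_, fun z hz z' hz' => ⟨?_, ?_⟩⟩
  · filter_upwards [hU.mem_nhds h0U] with q hq using hl q hq
  · refine (hL1.norm_sub_le (hWs hz).1.2 (hWs hz').1.2).trans ?_
    gcongr
    linarith [le_max_left (K1 : ℝ) K2]
  · have := hL2.norm_sub_le (hWs hz).2 (hWs hz').2
    rw [hr z (hWs hz).1.1, hr z' (hWs hz').1.1] at this
    refine this.trans ?_
    gcongr
    linarith [le_max_right (K1 : ℝ) K2]

theorem aEquiv_momentSum_fCS1p {a b : ℝ → ℝ} (ha : ContDiff ℝ (⊤ : ℕ∞) a)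
    (hb : ContDiff ℝ (⊤ : ℕ∞) b) (ha0 : 0 < a 0) (hb0 : 0 < b 0) {k1 k2 : ℝ} (hk1 : 0 < k1)
    (hab : ∀ᶠ x in nhds 0, k1 * x ^ 2 ≤ a x - b x ∧ a x - b x ≤ k2 * x ^ 2) :
    AEquiv (fun q => (momentSum 0 a b q, momentSum 1 a b q, momentSum 2 a b q)) 0
      fCS1p (0, 0) := by
  obtain ⟨Φ, hΦ, hΦ0, Y0, hY0, hΦe⟩ := exists_fold_coordinates ha hb ha0 hb0
  obtain ⟨V, i, K, hK, hV, h0V, hi, hi0, hr, hl, hLip⟩ := hΦ.exists_inverse_lipschitz hΦ0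
  obtain ⟨Z, hZ, hZc, hZe⟩ := exists_contDiff_eventuallyEq hV h0V
    ((contDiff_momentSum ha hb 2).comp_contDiffOn hi)
  have hVn : V ∈ nhds (0 : R2) := hV.mem_nhds h0V
  have hic : Tendsto i (nhds 0) (nhds 0) := by
    have := (hi.continuousOn.continuousAt hVn).tendsto
    rwa [hi0] at this
  have hΦc : Tendsto Φ (nhds 0) (nhds 0) := by
    obtain ⟨U, _, _, hU, h0U, _, _, h, _⟩ := hΦ
    have := (h.continuousOn.continuousAt (hU.mem_nhds h0U)).tendsto
    rwa [hΦ0] at this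
  obtain ⟨α, hα, hαa, hαb⟩ : ∃ α > 0, α < a 0 ∧ α < b 0 := by
    obtain ⟨α, h1, h2⟩ := exists_between (lt_min ha0 hb0)
    exact ⟨α, h1, lt_min_iff.1 h2⟩
  have hloc : ∀ᶠ x in nhds (0 : ℝ), (α ≤ a x ∧ α ≤ b x ∧ a x ≤ a 0 + 1) ∧
      k1 * x ^ 2 ≤ a x - b x ∧ a x - b x ≤ k2 * x ^ 2 := by
    filter_upwards [ha.continuous.continuousAt.eventually (lt_mem_nhds hαa),
      hb.continuous.continuousAt.eventually (lt_mem_nhds hαb),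
      ha.continuous.continuousAt.eventually (gt_mem_nhds (lt_add_one (a 0))), hab]
      with x h1 h2 h3 h4 using ⟨⟨h1.le, h2.le, h3.le⟩, h4⟩
  obtain ⟨r', hr', hr'loc⟩ := Metric.eventually_nhds_iff.1 hloc
  obtain ⟨r, hr0, hrr'⟩ := exists_between hr'
  have hrloc : ∀ x, |x| ≤ r → (α ≤ a x ∧ α ≤ b x ∧ a x ≤ a 0 + 1) ∧
      k1 * x ^ 2 ≤ a x - b x ∧ a x - b x ≤ k2 * x ^ 2 := fun x hx =>
    hr'loc (by rw [Real.dist_eq, sub_zero]; linarith)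
  have hk2 : 0 ≤ k2 := by
    obtain ⟨h1, h2⟩ := (hrloc r (abs_of_pos hr0).le).2
    have : k1 * r ^ 2 ≤ k2 * r ^ 2 := h1.trans h2
    exact hk1.le.trans (le_of_mul_le_mul_right this (by positivity))
  have hbox : ∀ᶠ z in nhds (0 : R2), (z ∈ V ∧ Z z = momentSum 2 a b (i z)) ∧
      (|(i z).1| ≤ r ∧ |(i z).2| ≤ r) ∧
      z.1 = momentSum 0 a b (i z) ∧ momentSum 1 a b (i z) = Y0 z.1 + z.2 ^ 2 ∧
        (0 < z.2 → (i z).2 < (i z).1) ∧ (z.2 < 0 → (i z).1 < (i z).2) := by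
    have hsmall : ∀ᶠ q in nhds (0 : R2), |q.1| ≤ r ∧ |q.2| ≤ r := by
      filter_upwards [Metric.closedBall_mem_nhds (0 : R2) hr0] with q hq
      simpa [Prod.norm_def] using hq
    filter_upwards [hVn, hZe, hic.eventually hsmall, hic.eventually hΦe] with z h1 h2 h3 h4
    rw [hr z h1] at h4
    exact ⟨⟨h1, h2⟩, h3, h4⟩
  obtain ⟨δ, hδ, hδbox⟩ := exists_forall_abs_lt_of_eventually hbox
  refine (aEquiv_of_source (f2 := fun q => (q.1, Y0 q.1 + q.2 ^ 2, Z q)) hΦ hΦ0 ?_).trans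
    (aEquiv_fCS1p_of_odd_bounds hY0 hZ hZc (δ := δ)
      (c := k1 * (2 / (K * ((a 0 + 1) / α + 1))) ^ 3 / (480 * K ^ 2 * ((a 0 + 1) / α + 1) ^ 2))
      (C := 8 * k2 * K ^ 5) (by positivity) hδ ?_)
  · filter_upwards [hΦe, hl, hΦc.eventually hZe] with q ⟨h1, h2, _⟩ h3 h4
    simp only [Function.comp, h3] at h4
    rw [h1] at h2
    simp only [h1, h2, h4]
  · intro x v hx hv hvδ
    have hv' : |v| < δ := by rwa [abs_of_pos hv]
    obtain ⟨⟨hz, hZz⟩, ⟨hs, ht⟩, e0, e1, hlt, -⟩ := hδbox x v hx hv'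
    obtain ⟨⟨hz', hZz'⟩, ⟨hs', ht'⟩, e0', e1', -, hlt'⟩ := hδbox x (-v) hx (by rwa [abs_neg])
    have hlip := hLip _ hz _ hz'
    have hlip0 := hLip _ hz _ h0V
    have hlip0' := (hLip _ hz' _ h0V).1
    rw [hi0, sub_zero, sub_zero] at hlip0 hlip0'
    replace hlt := hlt hv
    replace hlt' := hlt' (neg_neg_of_pos hv)
    rw [hZz, hZz']
    generalize i (x, v) = q at *
    generalize i (x, -v) = q' at *
    obtain ⟨s, t⟩ := q
    obtain ⟨s', t'⟩ := q'
    simp only [momentSum, Prod.norm_def, Prod.fst_sub, Prod.snd_sub, Real.norm_eq_abs, sub_self,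
      abs_zero, sub_neg_eq_add, ← two_mul, abs_neg, neg_sq] at *
    have h2v : max 0 |2 * v| = 2 * v := by
      rw [abs_of_pos (by linarith), max_eq_right (by linarith)]
    rw [h2v] at hlip
    have m0 : ∫ x in s'..s, a x = ∫ x in t..t', b x := by
      have h1 := moment_sub ha.continuous 0 s s'
      have h2 := moment_sub hb.continuous 0 t' t
      simp only [pow_zero, one_mul] at h1 h2
      linarith
    have m1 : ∫ x in s'..s, x * a x = ∫ x in t..t', x * b x := by
      have h1 := moment_sub ha.continuous 1 s s'
      have h2 := moment_sub hb.continuous 1 t' t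
      simp only [pow_one] at h1 h2
      linarith
    have m2 : moment 2 a s' + moment 2 b t' - (moment 2 a s + moment 2 b t) =
        (∫ x in t..t', x ^ 2 * b x) - (∫ x in s'..s, x ^ 2 * a x) := by
      rw [← moment_sub ha.continuous, ← moment_sub hb.continuous]; ring
    have habs : ∀ {α β x : ℝ}, |α| ≤ r → |β| ≤ r → x ∈ Set.Icc α β → |x| ≤ r := fun h1 h2 hx =>
      abs_le.2 ⟨by linarith [(abs_le.1 h1).1, hx.1], by linarith [(abs_le.1 h2).2, hx.2]⟩
    have hba : ∀ {g : ℝ → ℝ} {α β c : ℝ}, Continuous g → α ≤ β →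
        (∀ x ∈ Set.Icc α β, c ≤ g x) → c * (β - α) ≤ ∫ x in α..β, g x := by
      intro g α β c hg hle hc
      have := intervalIntegral.integral_mono_on (μ := MeasureTheory.volume) hle
        (continuous_const.intervalIntegrable α β) (hg.intervalIntegrable α β) hc
      rwa [intervalIntegral.integral_const, smul_eq_mul, mul_comm] at this
    have hss : s' < s := by
      by_contra! h
      have h1 := hba ha.continuous h fun x hx => (hrloc x (habs hs hs' hx)).1.1
      have h2 := hba hb.continuous (by linarith : t ≤ t') fun x hx =>
        (hrloc x (habs ht ht' hx)).1.2.1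
      rw [← m0, intervalIntegral.integral_symm] at h2
      have h3 : 0 < α * (t' - t) := mul_pos hα (by linarith)
      have h4 : 0 ≤ α * (s' - s) := mul_nonneg hα.le (by linarith)
      linarith
    have htt : t < t' := by
      by_contra! h
      have h1 := hba ha.continuous hss.le fun x hx => (hrloc x (habs hs' hs hx)).1.1
      have h2 := hba hb.continuous h fun x hx => (hrloc x (habs ht' ht hx)).1.2.1
      rw [intervalIntegral.integral_symm, ← m0] at h2
      have h3 : 0 < α * (s - s') := mul_pos hα (by linarith)
      have h4 : 0 ≤ α * (t - t') := mul_nonneg hα.le (by linarith)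
      linarith
    have hM' : t' - t ≤ (a 0 + 1) / α * (s - s') := by
      have h1 := hba hb.continuous htt.le fun x hx => (hrloc x (habs ht ht' hx)).1.2.1
      have h2 := hba ha.continuous.neg hss.le fun x hx =>
        neg_le_neg (hrloc x (habs hs' hs hx)).1.2.2
      simp only [Pi.neg_apply, intervalIntegral.integral_neg] at h2
      rw [div_mul_eq_mul_div, le_div_iff₀ hα]
      linarith
    obtain ⟨b1, b2⟩ := second_moment_diff_bounds ha.continuous hb.continuous hk2
      (fun x hx => ⟨hα.le.trans (hrloc x hx).1.1, hα.le.trans (hrloc x hx).1.2.1,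
        (hrloc x hx).2⟩) hs hs' ht ht' hss.le htt.le
      ((le_max_right _ _).trans hlip0.1) ((le_max_right _ _).trans hlip0') m0 m1
    rw [m2]
    exact ⟨(two_point_lower_bound hK (by positivity) hk1 hv hss htt hlt hlt' hM'
      ((le_max_left _ _).trans hlip0.2) hlip.2).trans b1,
      b2.trans (two_point_upper_bound hK hk2 hv htt ((le_max_right _ _).trans hlip.1))⟩

theorem contDiffAt_phiW {g w : ℝ → ℝ} (hg : ContDiff ℝ (⊤ : ℕ∞) g) (hw : ContDiff ℝ (⊤ : ℕ∞) w)
    {x : ℝ} (hgx : g x ≠ 0) (hwx : w x ≠ 0) : ContDiffAt ℝ (⊤ : ℕ∞) (phiW g w) x :=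
  ((contDiff_infty_iff_deriv.1 hg).2.contDiffAt).div ((hg.pow 2).mul hw).contDiffAt
    (mul_ne_zero (pow_ne_zero 2 hgx) hwx)

theorem ContDiffAt.contDiffAt_deriv_infty {f : ℝ → ℝ} {x : ℝ}
    (hf : ContDiffAt ℝ (⊤ : ℕ∞) f x) : ContDiffAt ℝ (⊤ : ℕ∞) (deriv f) x := by
  have h : ContDiffAt ℝ (⊤ : ℕ∞) (fun y => fderiv ℝ f y 1) x :=
    (hf.fderiv_right (m := (⊤ : ℕ∞)) (by simp)).clm_apply contDiffAt_const
  exact h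

theorem contDiffAt_PhiW {g w : ℝ → ℝ} (hg : ContDiff ℝ (⊤ : ℕ∞) g) (hw : ContDiff ℝ (⊤ : ℕ∞) w)
    {x : ℝ} (hgx : g x ≠ 0) (hwx : w x ≠ 0) (hdg : deriv g x ≠ 0) :
    ContDiffAt ℝ (⊤ : ℕ∞) (PhiW g w) x :=
  (hg.contDiffAt.div (contDiff_infty_iff_deriv.1 hg).2.contDiffAt hdg).mul
    (contDiffAt_phiW hg hw hgx hwx).contDiffAt_deriv_infty

/-- The derivatives of `φ₁ - φ₂` along a curve in the singular set `g₁ g₂ = 1`. -/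
theorem deriv_phiW_sub_along_curve {g1 g2 w1 w2 σ τ : ℝ → ℝ} (hg1 : ContDiff ℝ (⊤ : ℕ∞) g1)
    (hg2 : ContDiff ℝ (⊤ : ℕ∞) g2) (hw1 : ContDiff ℝ (⊤ : ℕ∞) w1)
    (hw2 : ContDiff ℝ (⊤ : ℕ∞) w2) (h1 : ∀ u, w1 u ≠ 0) (h2 : ∀ v, w2 v ≠ 0)
    (hσ : ContDiffAt ℝ (⊤ : ℕ∞) σ 0) (hτ : ContDiffAt ℝ (⊤ : ℕ∞) τ 0)
    (hst : ∀ᶠ x in nhds 0, g1 (σ x) * g2 (τ x) = 1) (hd1 : deriv g1 (σ 0) ≠ 0)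
    (hd2 : deriv g2 (τ 0) ≠ 0) (hσ0 : deriv σ 0 ≠ 0) :
    ContDiffAt ℝ (⊤ : ℕ∞) (fun x => phiW g1 w1 (σ x) - phiW g2 w2 (τ x)) 0 ∧
    ∃ m, m ≠ 0 ∧
      deriv (fun x => phiW g1 w1 (σ x) - phiW g2 w2 (τ x)) 0 =
        m * (PhiW g1 w1 (σ 0) + PhiW g2 w2 (τ 0)) ∧
      (PhiW g1 w1 (σ 0) + PhiW g2 w2 (τ 0) = 0 →
        deriv (deriv fun x => phiW g1 w1 (σ x) - phiW g2 w2 (τ x)) 0 =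
          m ^ 2 * (g1 (σ 0) / deriv g1 (σ 0) * deriv (PhiW g1 w1) (σ 0)
            - g2 (τ 0) / deriv g2 (τ 0) * deriv (PhiW g2 w2) (τ 0))) := by
  have htop : ((⊤ : ℕ∞) : WithTop ℕ∞) ≠ 0 := by simp
  have hne : ∀ᶠ x in nhds 0, g1 (σ x) ≠ 0 ∧ g2 (τ x) ≠ 0 :=
    hst.mono fun x hx => ⟨left_ne_zero_of_mul_eq_one hx, right_ne_zero_of_mul_eq_one hx⟩
  obtain ⟨hn1, hn2⟩ := hne.self_of_nhds
  have dg1 := (contDiff_infty_iff_deriv.1 hg1).2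
  have dg2 := (contDiff_infty_iff_deriv.1 hg2).2
  have hd1' : ∀ᶠ x in nhds 0, deriv g1 (σ x) ≠ 0 :=
    (ContinuousAt.comp (f := σ) dg1.continuous.continuousAt hσ.continuousAt).eventually_ne hd1
  have hd2' : ∀ᶠ x in nhds 0, deriv g2 (τ x) ≠ 0 :=
    (ContinuousAt.comp (f := τ) dg2.continuous.continuousAt hτ.continuousAt).eventually_ne hd2
  have hσd : ∀ᶠ x in nhds 0, HasDerivAt σ (deriv σ x) x :=
    ((hσ.of_le (by simp : (1 : WithTop ℕ∞) ≤ (⊤ : ℕ∞))).eventually (by simp)).mono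
      fun x hx => (hx.differentiableAt (by simp)).hasDerivAt
  have hτd : ∀ᶠ x in nhds 0, HasDerivAt τ (deriv τ x) x :=
    ((hτ.of_le (by simp : (1 : WithTop ℕ∞) ≤ (⊤ : ℕ∞))).eventually (by simp)).mono
      fun x hx => (hx.differentiableAt (by simp)).hasDerivAt
  have hrel : ∀ᶠ x in nhds 0, deriv g1 (σ x) * deriv σ x * g2 (τ x) +
      g1 (σ x) * (deriv g2 (τ x) * deriv τ x) = 0 := by
    filter_upwards [hst.eventually_nhds, hσd, hτd] with x hx h3 h4
    have k1 := ((hg1.differentiable htop (σ x)).hasDerivAt).comp x h3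
    have k2 := ((hg2.differentiable htop (τ x)).hasDerivAt).comp x h4
    exact (k1.mul k2).unique ((hasDerivAt_const x (1 : ℝ)).congr_of_eventuallyEq hx)
  have hφ1 := contDiffAt_phiW hg1 hw1 hn1 (h1 _)
  have hφ2 := contDiffAt_phiW hg2 hw2 hn2 (h2 _)
  have hΦ1 := contDiffAt_PhiW hg1 hw1 hn1 (h1 _) hd1
  have hΦ2 := contDiffAt_PhiW hg2 hw2 hn2 (h2 _) hd2
  have hm : DifferentiableAt ℝ (fun x => deriv g1 (σ x) * deriv σ x / g1 (σ x)) 0 := by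
    have e1 : ContDiffAt ℝ (⊤ : ℕ∞) (fun x => deriv g1 (σ x)) 0 := dg1.contDiffAt.comp 0 hσ
    have e2 : ContDiffAt ℝ (⊤ : ℕ∞) (fun x => g1 (σ x)) 0 := hg1.contDiffAt.comp 0 hσ
    exact ((e1.mul hσ.contDiffAt_deriv_infty).div e2 hn1).differentiableAt htop
  have hD : deriv (fun x => phiW g1 w1 (σ x) - phiW g2 w2 (τ x)) =ᶠ[nhds 0]
      fun x => deriv g1 (σ x) * deriv σ x / g1 (σ x) *
        (PhiW g1 w1 (σ x) + PhiW g2 w2 (τ x)) := by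
    filter_upwards [hne, hd1', hd2', hσd, hτd, hrel] with x ⟨k1, k2⟩ k3 k4 k5 k6 k7
    have d1 := (((contDiffAt_phiW hg1 hw1 k1 (h1 _)).differentiableAt htop).hasDerivAt).comp x k5
    have d2 := (((contDiffAt_phiW hg2 hw2 k2 (h2 _)).differentiableAt htop).hasDerivAt).comp x k6
    refine (d1.sub d2).deriv.trans ?_
    have : deriv τ x = -(deriv g1 (σ x) * deriv σ x / g1 (σ x)) *
        (g2 (τ x) / deriv g2 (τ x)) := by
      field_simp
      linarith
    simp only [PhiW]
    rw [this]
    field_simp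
    ring
  have S' : HasDerivAt (fun x => PhiW g1 w1 (σ x) + PhiW g2 w2 (τ x))
      (deriv (PhiW g1 w1) (σ 0) * deriv σ 0 + deriv (PhiW g2 w2) (τ 0) * deriv τ 0) 0 :=
    (((hΦ1.differentiableAt htop).hasDerivAt).comp 0 hσd.self_of_nhds).add
      (((hΦ2.differentiableAt htop).hasDerivAt).comp 0 hτd.self_of_nhds)
  refine ⟨(ContDiffAt.comp 0 hφ1 hσ).sub (ContDiffAt.comp 0 hφ2 hτ),
    deriv g1 (σ 0) * deriv σ 0 / g1 (σ 0), div_ne_zero (mul_ne_zero hd1 hσ0) hn1,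
    hD.self_of_nhds, fun hS => ?_⟩
  rw [hD.deriv_eq]
  refine (hm.hasDerivAt.mul S').deriv.trans ?_
  have k7 := hrel.self_of_nhds
  have : deriv τ 0 = -(deriv g1 (σ 0) * deriv σ 0 / g1 (σ 0)) *
      (g2 (τ 0) / deriv g2 (τ 0)) := by
    field_simp
    linarith
  rw [hS, this]
  field_simp
  ring

/-- The map whose components are the first three moment sums of `a` and `b`. -/
def momentMap (a b : ℝ → ℝ) (q : R2) : R3 :=
  (momentSum 0 a b q, momentSum 1 a b q, momentSum 2 a b q)

theorem momentSum_neg (i : ℕ) (a b : ℝ → ℝ) (q : R2) :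
    momentSum i (-a) (-b) q = -momentSum i a b q := by
  simp only [momentSum, moment, Pi.neg_apply, mul_neg, intervalIntegral.integral_neg]
  ring

theorem aEquiv_momentMap_neg (a b : ℝ → ℝ) :
    AEquiv (momentMap a b) 0 (momentMap (-a) (-b)) 0 := by
  refine aEquiv_of_target (Ψ := fun y => -y) (isLocalDiffeoAt_of_inverse (Ψ := fun y => -y)
    contDiff_neg contDiff_neg neg_neg neg_neg _) (Eventually.of_forall fun q => ?_)
  simp only [momentMap, momentSum_neg, Prod.neg_mk]

theorem aEquiv_momentMap_swap (a b : ℝ → ℝ) :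
    AEquiv (momentMap a b) 0 (momentMap b a) 0 := by
  refine aEquiv_of_source (Φ := Prod.swap) (isLocalDiffeoAt_of_inverse (Ψ := Prod.swap)
    (contDiff_snd.prodMk contDiff_fst) (contDiff_snd.prodMk contDiff_fst) Prod.swap_swap
    Prod.swap_swap _) rfl (Eventually.of_forall fun q => ?_)
  simp only [momentMap, momentSum, Prod.fst_swap, Prod.snd_swap, add_comm]

theorem aEquiv_momentMap_fCS1p {a b e : ℝ → ℝ} (ha : ContDiff ℝ (⊤ : ℕ∞) a)
    (hb : ContDiff ℝ (⊤ : ℕ∞) b) (ha0 : a 0 ≠ 0) (he : ContinuousAt e 0) (he0 : e 0 ≠ 0)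
    (hab : ∀ᶠ x in nhds 0, a x - b x = x ^ 2 * e x) :
    AEquiv (momentMap a b) 0 fCS1p (0, 0) := by
  have pos : ∀ {a b e : ℝ → ℝ}, ContDiff ℝ (⊤ : ℕ∞) a → ContDiff ℝ (⊤ : ℕ∞) b → 0 < a 0 →
      ContinuousAt e 0 → 0 < e 0 → (∀ᶠ x in nhds 0, a x - b x = x ^ 2 * e x) →
      AEquiv (momentMap a b) 0 fCS1p (0, 0) := by
    intro a b e ha hb ha0 he he0 hab
    have h0 := hab.self_of_nhds
    refine aEquiv_momentSum_fCS1p (k1 := e 0 / 2) (k2 := e 0 + 1) ha hb ha0 (by linarith)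
      (by linarith) ?_
    filter_upwards [hab, he.eventually (lt_mem_nhds (half_lt_self he0)),
      he.eventually (gt_mem_nhds (lt_add_one (e 0)))] with x h1 h2 h3
    rw [h1]
    constructor <;> nlinarith [sq_nonneg x]
  have posa : ∀ {a b e : ℝ → ℝ}, ContDiff ℝ (⊤ : ℕ∞) a → ContDiff ℝ (⊤ : ℕ∞) b → 0 < a 0 →
      ContinuousAt e 0 → e 0 ≠ 0 → (∀ᶠ x in nhds 0, a x - b x = x ^ 2 * e x) →
      AEquiv (momentMap a b) 0 fCS1p (0, 0) := by
    intro a b e ha hb ha0 he he0 hab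
    rcases he0.lt_or_gt with h | h
    · have h0 := hab.self_of_nhds
      exact (aEquiv_momentMap_swap a b).trans (pos (e := -e) hb ha (by linarith) he.neg
        (by simpa using h) (hab.mono fun x hx => by
          simp only [Pi.neg_apply]; linarith))
    · exact pos ha hb ha0 he h hab
  rcases ha0.lt_or_gt with h | h
  · exact (aEquiv_momentMap_neg a b).trans (posa (e := -e) ha.neg hb.neg (by simpa using h)
      he.neg (by simpa using he0) (hab.mono fun x hx => by
          simp only [Pi.neg_apply]; linarith))
  · exact posa ha hb h he he0 hab

theorem IsLocalDiffeoAt.prodMap {E F E' F' : Type*} [NormedAddCommGroup E] [NormedSpace ℝ E]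
    [NormedAddCommGroup F] [NormedSpace ℝ F] [NormedAddCommGroup E'] [NormedSpace ℝ E']
    [NormedAddCommGroup F'] [NormedSpace ℝ F'] {Φ : E → F} {Φ' : E' → F'} {p : E × E'}
    (h : IsLocalDiffeoAt Φ p.1) (h' : IsLocalDiffeoAt Φ' p.2) :
    IsLocalDiffeoAt (Prod.map Φ Φ') p := by
  obtain ⟨U, V, i, hU, hpU, hV, hpV, h1, h2, h3, h4, h5, h6⟩ := h
  obtain ⟨U', V', i', hU', hpU', hV', hpV', h1', h2', h3', h4', h5', h6'⟩ := h'
  exact ⟨U ×ˢ U', V ×ˢ V', Prod.map i i', hU.prod hU', ⟨hpU, hpU'⟩, hV.prod hV', ⟨hpV, hpV'⟩,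
    h1.prodMap h1', h2.prodMap h2', h3.prodMap h3', h4.prodMap h4',
    fun x hx => Prod.ext (h5 _ hx.1) (h5' _ hx.2), fun x hx => Prod.ext (h6 _ hx.1) (h6' _ hx.2)⟩

theorem IsLocalDiffeoAt.exists_contDiff_inverse {E F : Type*} [NormedAddCommGroup E]
    [NormedSpace ℝ E] [NormedAddCommGroup F] [NormedSpace ℝ F] [FiniteDimensional ℝ F] {Φ : E → F}
    {p : E} (h : IsLocalDiffeoAt Φ p) :
    ∃ Θ : F → E, ContDiff ℝ (⊤ : ℕ∞) Θ ∧ Θ (Φ p) = p ∧ (∀ᶠ x in nhds p, Θ (Φ x) = x) ∧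
      (∀ᶠ y in nhds (Φ p), Φ (Θ y) = y) ∧ Function.Injective (fderiv ℝ Θ (Φ p)) := by
  obtain ⟨U, V, i, hU, hpU, hV, hpV, h1, h2, -, -, h5, h6⟩ := h
  obtain ⟨Θ, h7, -, h8⟩ := exists_contDiff_eventuallyEq hV hpV h2
  have hΦ := h1.contDiffAt (hU.mem_nhds hpU)
  have hp : Θ (Φ p) = p := h8.self_of_nhds.trans (h5 _ hpU)
  have hr : ∀ᶠ y in nhds (Φ p), Φ (Θ y) = y := by
    filter_upwards [h8, hV.mem_nhds hpV] with y hy hy'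
    rw [hy, h6 _ hy']
  refine ⟨Θ, h7, hp, ?_, hr, ?_⟩
  · filter_upwards [hΦ.continuousAt.eventually h8, hU.mem_nhds hpU] with x hx hx'
    rw [hx, h5 _ hx']
  · have k1 : HasFDerivAt Φ (fderiv ℝ Φ p) (Θ (Φ p)) := by
      rw [hp]; exact (hΦ.differentiableAt (by simp)).hasFDerivAt
    have k := (k1.comp (Φ p) (h7.differentiable (by simp) (Φ p)).hasFDerivAt).unique
      ((hasFDerivAt_id (Φ p)).congr_of_eventuallyEq hr)
    exact Function.LeftInverse.injective (g := fderiv ℝ Φ p) fun y => congrArg (fun L => L y) k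

theorem isLocalDiffeoAt_of_deriv_ne_zero {h : ℝ → ℝ} {U : Set ℝ} (hU : IsOpen U) {p : ℝ}
    (hp : p ∈ U) (hh : ContDiffOn ℝ (⊤ : ℕ∞) h U) (hd : deriv h p ≠ 0) : IsLocalDiffeoAt h p := by
  refine isLocalDiffeoAt_of_contDiffOn hU hp hh ((injective_iff_map_eq_zero _).2 fun x hx => ?_)
  have : fderiv ℝ h p x = x * deriv h p := fderiv_eq_smul_deriv x
  rw [this] at hx
  exact (mul_eq_zero.1 hx).resolve_right hd

theorem tendsto_div_sq {D : ℝ → ℝ} (hD : ContDiffAt ℝ (⊤ : ℕ∞) D 0) (h0 : D 0 = 0)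
    (h1 : deriv D 0 = 0) :
    Tendsto (fun x => D x / x ^ 2) (nhdsWithin 0 {0}ᶜ) (nhds (deriv (deriv D) 0 / 2)) := by
  have hd : ∀ᶠ x in nhds 0, HasDerivAt D (deriv D x) x :=
    ((hD.of_le (by simp : (1 : WithTop ℕ∞) ≤ (⊤ : ℕ∞))).eventually (by simp)).mono
      fun x hx => (hx.differentiableAt (by simp)).hasDerivAt
  have hdd := (hD.contDiffAt_deriv_infty.differentiableAt (by simp)).hasDerivAt
  refine HasDerivAt.lhopital_zero_nhdsNE (f' := deriv D) (g' := fun x => 2 * x)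
    (eventually_nhdsWithin_of_eventually_nhds hd)
    (Eventually.of_forall fun x => by simpa using hasDerivAt_pow 2 x)
    (eventually_nhdsWithin_of_forall fun x hx => mul_ne_zero two_ne_zero hx) ?_ ?_ ?_
  · have := hD.continuousAt.tendsto
    rw [h0] at this
    exact this.mono_left nhdsWithin_le_nhds
  · have : Tendsto (fun x : ℝ => x ^ 2) (nhds 0) (nhds (0 ^ 2)) :=
      (continuous_pow 2).continuousAt.tendsto
    rw [zero_pow two_ne_zero] at this
    exact this.mono_left nhdsWithin_le_nhds
  · refine ((hasDerivAt_iff_tendsto_slope.1 hdd).div_const 2).congr' ?_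
    filter_upwards [self_mem_nhdsWithin] with x hx
    rw [slope_def_field, h1]
    field_simp
    simp

theorem IsGTMS.hasFDerivAt {f : R2 → R3} {g1 g2 w1 w2 : ℝ → ℝ} (hf : IsGTMS f g1 g2 w1 w2)
    (q : R2) : HasFDerivAt f
      ((ContinuousLinearMap.fst ℝ ℝ ℝ).smulRight (((-1 - g1 q.1 ^ 2) * w1 q.1 / 2,
        (1 - g1 q.1 ^ 2) * w1 q.1 / 2, g1 q.1 * w1 q.1) : R3) +
      (ContinuousLinearMap.snd ℝ ℝ ℝ).smulRight (((1 + g2 q.2 ^ 2) * w2 q.2 / 2,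
        (1 - g2 q.2 ^ 2) * w2 q.2 / 2, -(g2 q.2 * w2 q.2)) : R3)) q := by
  refine ((hf.smooth_f.differentiable (by simp)) q).hasFDerivAt.congr_fderiv ?_
  rw [← hf.deriv_u q, ← hf.deriv_v q]
  refine ContinuousLinearMap.ext fun x => ?_
  have : x = x.1 • ((1, 0) : R2) + x.2 • ((0, 1) : R2) := by ext <;> simp
  conv_lhs => rw [this, map_add, map_smul, map_smul]
  simp [pu, pv]

theorem hasFDerivAt_momentSum_prodMap {a b χ1 χ2 : ℝ → ℝ} (ha : Continuous a) (hb : Continuous b)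
    {q : R2} {d1 d2 : ℝ} (h1 : HasDerivAt χ1 d1 q.1) (h2 : HasDerivAt χ2 d2 q.2) (i : ℕ) :
    HasFDerivAt (fun q => momentSum i a b (Prod.map χ1 χ2 q))
      ((χ1 q.1 ^ i * a (χ1 q.1) * d1) • ContinuousLinearMap.fst ℝ ℝ ℝ +
        (χ2 q.2 ^ i * b (χ2 q.2) * d2) • ContinuousLinearMap.snd ℝ ℝ ℝ) q :=
  (HasDerivAt.comp_hasFDerivAt (h₂ := fun x => moment i a (χ1 x)) q
    (HasDerivAt.comp q.1 (hasDerivAt_moment ha i (χ1 q.1)) h1) hasFDerivAt_fst).add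
  (HasDerivAt.comp_hasFDerivAt (h₂ := fun x => moment i b (χ2 x)) q
    (HasDerivAt.comp q.2 (hasDerivAt_moment hb i (χ2 q.2)) h2) hasFDerivAt_snd)

/-- The linear map sending the moments of a measure `a` on the line to
`∫ (-1 - (s + x)², 1 - (s + x)², 2 (s + x)) a(x) dx`. -/
def nullMap (s : ℝ) (m : R3) : R3 :=
  (-(1 + s ^ 2) * m.1 - 2 * s * m.2.1 - m.2.2,
    (1 - s ^ 2) * m.1 - 2 * s * m.2.1 - m.2.2, 2 * s * m.1 + 2 * m.2.1)

theorem IsGTMS.eventually_eq_nullMap_momentMap {f : R2 → R3} {g1 g2 w1 w2 : ℝ → ℝ}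
    (hf : IsGTMS f g1 g2 w1 w2) {p : R2} (hp : g1 p.1 * g2 p.2 = 1) {a b : ℝ → ℝ}
    (ha : Continuous a) (hb : Continuous b)
    (haw : ∀ᶠ u in nhds p.1, 2 * a (g1 u - g1 p.1) * deriv g1 u = w1 u)
    (hbw : ∀ᶠ v in nhds p.2,
      2 * b ((g2 v)⁻¹ - g1 p.1) * deriv g2 v = w2 v * g2 v ^ 4) :
    ∀ᶠ q in nhds p, f q = f p + nullMap (g1 p.1) (momentMap a b
      (Prod.map (fun u => g1 u - g1 p.1) (fun v => (g2 v)⁻¹ - g1 p.1) q)) := by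
  have hg2 : ∀ᶠ v in nhds p.2, g2 v ≠ 0 :=
    hf.smooth_g2.continuous.continuousAt.eventually_ne (right_ne_zero_of_mul_eq_one hp)
  have ev := (continuousAt_fst (p := p)).eventually haw |>.and
    ((continuousAt_snd (p := p)).eventually (hbw.and hg2))
  obtain ⟨r, hr, hball⟩ := Metric.eventually_nhds_iff_ball.1 ev
  set H : R2 → R3 := fun q => f q - nullMap (g1 p.1) (momentMap a b
      (Prod.map (fun u => g1 u - g1 p.1) (fun v => (g2 v)⁻¹ - g1 p.1) q)) with hH
  have hH0 : H p = f p := by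
    have : (g2 p.2)⁻¹ = g1 p.1 := (eq_inv_of_mul_eq_one_left hp).symm
    simp [hH, nullMap, momentMap, momentSum, this, moment_zero]
  have hd : ∀ q ∈ Metric.ball p r, HasFDerivAt H (0 : R2 →L[ℝ] R3) q := by
    intro q hq
    obtain ⟨e1, e2, e3⟩ := hball q hq
    have k1 : HasDerivAt (fun u => g1 u - g1 p.1) (deriv g1 q.1) q.1 :=
      ((hf.smooth_g1.differentiable (by simp)) q.1).hasDerivAt.sub_const _
    have k2 : HasDerivAt (fun v => (g2 v)⁻¹ - g1 p.1) (-deriv g2 q.2 / g2 q.2 ^ 2) q.2 :=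
      (((hf.smooth_g2.differentiable (by simp)) q.2).hasDerivAt.inv e3).sub_const _
    have m := hasFDerivAt_momentSum_prodMap ha hb k1 k2
    have c1 := (((m 0).const_mul (-(1 + g1 p.1 ^ 2))).sub ((m 1).const_mul (2 * g1 p.1))).sub (m 2)
    have c2 := (((m 0).const_mul (1 - g1 p.1 ^ 2)).sub ((m 1).const_mul (2 * g1 p.1))).sub (m 2)
    have c3 := ((m 0).const_mul (2 * g1 p.1)).add ((m 1).const_mul 2)
    refine ((hf.hasFDerivAt q).sub (c1.prodMk (c2.prodMk c3))).congr_fderiv ?_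
    have e2' : b ((g2 q.2)⁻¹ - g1 p.1) * (-deriv g2 q.2 / g2 q.2 ^ 2) =
        -w2 q.2 * g2 q.2 ^ 2 / 2 := by
      generalize b ((g2 q.2)⁻¹ - g1 p.1) = B at e2 ⊢
      field_simp
      linear_combination (-1) * e2
    refine ContinuousLinearMap.ext fun x => ?_
    simp only [mul_assoc, e2', pow_zero, pow_one, one_mul]
    simp only [Prod.ext_iff, sub_apply, add_apply,
      ContinuousLinearMap.prod_apply, ContinuousLinearMap.smulRight_apply,
      smul_apply, ContinuousLinearMap.coe_fst', ContinuousLinearMap.coe_snd',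
      zero_apply, smul_eq_mul, Prod.fst_sub, Prod.snd_sub, Prod.fst_add,
      Prod.snd_add, Prod.smul_fst, Prod.smul_snd, Prod.fst_zero, Prod.snd_zero, ← e1]
    refine ⟨?_, ?_, ?_⟩ <;>
    · field_simp
      ring
  filter_upwards [Metric.ball_mem_nhds p hr] with q hq
  have := (convex_ball p r).is_const_of_fderivWithin_eq_zero (𝕜 := ℝ) (f := H)
    (fun q hq => (hd q hq).differentiableAt.differentiableWithinAt)
    (fun q hq => by
      rw [fderivWithin_of_isOpen Metric.isOpen_ball hq]; exact (hd q hq).fderiv)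
    hq (Metric.mem_ball_self hr)
  rw [hH0] at this
  rw [← this]
  simp [hH]

theorem isLocalDiffeoAt_nullMap_inverse (s : ℝ) (c y : R3) :
    ∃ Ψ : R3 → R3, IsLocalDiffeoAt Ψ y ∧ ∀ m, Ψ (c + nullMap s m) = m := by
  refine ⟨fun y => ((y.2.1 - c.2.1 - (y.1 - c.1)) / 2,
    (y.2.2 - c.2.2) / 2 - s * ((y.2.1 - c.2.1 - (y.1 - c.1)) / 2),
    -(1 + s ^ 2) * ((y.2.1 - c.2.1 - (y.1 - c.1)) / 2) - 2 * s *
      ((y.2.2 - c.2.2) / 2 - s * ((y.2.1 - c.2.1 - (y.1 - c.1)) / 2)) - (y.1 - c.1)),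
    isLocalDiffeoAt_of_inverse (Ψ := fun m => c + nullMap s m) (by fun_prop)
      (by unfold nullMap; fun_prop) (fun x => ?_) (fun x => ?_) y, fun x => ?_⟩ <;>
  · simp only [nullMap, Prod.ext_iff, Prod.fst_add, Prod.snd_add]
    refine ⟨?_, ?_, ?_⟩ <;> ring

theorem aEquiv_fCS1p_of_conditions {f : R2 → R3} {g1 g2 w1 w2 : ℝ → ℝ}
    (hf : IsGTMS f g1 g2 w1 w2) (hw1 : ∀ u, w1 u ≠ 0) (hw2 : ∀ v, w2 v ≠ 0) {p : R2}
    (hp : g1 p.1 * g2 p.2 = 1) (hφ : phiW g1 w1 p.1 = phiW g2 w2 p.2) (hφ0 : phiW g1 w1 p.1 ≠ 0)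
    (hΦ : PhiW g1 w1 p.1 + PhiW g2 w2 p.2 = 0)
    (hΦ' : g1 p.1 / deriv g1 p.1 * deriv (PhiW g1 w1) p.1
         - g2 p.2 / deriv g2 p.2 * deriv (PhiW g2 w2) p.2 ≠ 0) :
    AEquiv f p fCS1p (0, 0) := by
  have hd1 : deriv g1 p.1 ≠ 0 := fun h => hφ0 (by simp [phiW, h])
  have hd2 : deriv g2 p.2 ≠ 0 := fun h => hφ0 (by rw [hφ]; simp [phiW, h])
  have hn1 : g1 p.1 ≠ 0 := left_ne_zero_of_mul_eq_one hp
  have hn2 : g2 p.2 ≠ 0 := right_ne_zero_of_mul_eq_one hp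
  have hinv : (g2 p.2)⁻¹ = g1 p.1 := (eq_inv_of_mul_eq_one_left hp).symm
  have hg1 := hf.smooth_g1
  have hg2 := hf.smooth_g2
  have dg1 := (contDiff_infty_iff_deriv.1 hg1).2
  have dg2 := (contDiff_infty_iff_deriv.1 hg2).2
  have hc1 : HasDerivAt (fun u => g1 u - g1 p.1) (deriv g1 p.1) p.1 :=
    ((hg1.differentiable (by simp)) p.1).hasDerivAt.sub_const _
  have hc2 : HasDerivAt (fun v => (g2 v)⁻¹ - g1 p.1) (-deriv g2 p.2 / g2 p.2 ^ 2) p.2 :=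
    (((hg2.differentiable (by simp)) p.2).hasDerivAt.inv hn2).sub_const _
  have l1 := isLocalDiffeoAt_of_deriv_ne_zero isOpen_univ (Set.mem_univ p.1)
    (h := fun u => g1 u - g1 p.1) (hg1.sub contDiff_const).contDiffOn (by rwa [hc1.deriv])
  have l2 := isLocalDiffeoAt_of_deriv_ne_zero
    (isOpen_ne_fun hg2.continuous continuous_const) (p := p.2) hn2
    (h := fun v => (g2 v)⁻¹ - g1 p.1)
    ((hg2.contDiffOn.inv fun x hx => hx).sub contDiffOn_const)
    (by rw [hc2.deriv]; exact div_ne_zero (neg_ne_zero.2 hd2) (pow_ne_zero 2 hn2))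
  obtain ⟨σ, hσ, hσ0, hσl, hσr, -⟩ := l1.exists_contDiff_inverse
  obtain ⟨τ, hτ, hτ0, hτl, hτr, -⟩ := l2.exists_contDiff_inverse
  simp only [sub_self, hinv] at hσ0 hσr hτ0 hτr
  obtain ⟨a, ha, -, hae⟩ := exists_contDiff_eventuallyEq (p := 0)
    (F := fun x => w1 (σ x) / (2 * deriv g1 (σ x)))
    (isOpen_ne_fun (dg1.comp hσ).continuous continuous_const) (by simpa [hσ0] using hd1)
    ((hf.smooth_w1.comp hσ).contDiffOn.div (contDiff_const.mul (dg1.comp hσ)).contDiffOn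
      fun x hx => mul_ne_zero two_ne_zero hx)
  obtain ⟨b, hb, -, hbe⟩ := exists_contDiff_eventuallyEq (p := 0)
    (F := fun x => w2 (τ x) * g2 (τ x) ^ 4 / (2 * deriv g2 (τ x)))
    (isOpen_ne_fun (dg2.comp hτ).continuous continuous_const) (by simpa [hτ0] using hd2)
    (((hf.smooth_w2.comp hτ).mul ((hg2.comp hτ).pow 4)).contDiffOn.div
      (contDiff_const.mul (dg2.comp hτ)).contDiffOn
      fun x hx => mul_ne_zero two_ne_zero hx)
  have haw : ∀ᶠ u in nhds p.1, 2 * a (g1 u - g1 p.1) * deriv g1 u = w1 u := by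
    have : Tendsto (fun u => g1 u - g1 p.1) (nhds p.1) (nhds 0) := by
      simpa using hc1.continuousAt.tendsto
    filter_upwards [this.eventually hae, hσl,
      dg1.continuous.continuousAt.eventually_ne hd1] with u k1 k2 k3
    rw [k1, k2]
    field_simp
  have hbw : ∀ᶠ v in nhds p.2, 2 * b ((g2 v)⁻¹ - g1 p.1) * deriv g2 v = w2 v * g2 v ^ 4 := by
    have : Tendsto (fun v => (g2 v)⁻¹ - g1 p.1) (nhds p.2) (nhds 0) := by
      simpa [hinv] using hc2.continuousAt.tendsto
    filter_upwards [this.eventually hbe, hτl,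
      dg2.continuous.continuousAt.eventually_ne hd2] with u k1 k2 k3
    rw [k1, k2]
    field_simp
  obtain ⟨Ψ, hΨ, hΨ'⟩ := isLocalDiffeoAt_nullMap_inverse (g1 p.1) (f p) (f p)
  have hev : ∀ᶠ q in nhds p, Ψ (f q) = momentMap a b
      (Prod.map (fun u => g1 u - g1 p.1) (fun v => (g2 v)⁻¹ - g1 p.1) q) := by
    filter_upwards [hf.eventually_eq_nullMap_momentMap hp ha.continuous hb.continuous haw hbw]
      with q hq
    rw [hq, hΨ']
  have hχ0 : Prod.map (fun u => g1 u - g1 p.1) (fun v => (g2 v)⁻¹ - g1 p.1) p = (0 : R2) := by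
    simp [Prod.map, hinv]
  have hpair : AEquiv f p (momentMap a b) 0 :=
    ⟨_, Ψ, l1.prodMap l2, hχ0, hΨ, by rw [hev.self_of_nhds, hχ0], hev⟩
  refine hpair.trans ?_
  have hst : ∀ᶠ x in nhds 0, g1 (σ x) * g2 (τ x) = 1 := by
    filter_upwards [hσr, hτr, (hg2.comp hτ).continuous.continuousAt.eventually_ne
      (by simpa [hτ0] using hn2)] with x h1 h2 h3
    have : (g2 (τ x))⁻¹ = g1 (σ x) := by linarith
    rw [← this]
    exact inv_mul_cancel₀ h3
  have hσ' : deriv σ 0 ≠ 0 := by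
    intro h
    have k := HasDerivAt.comp (0 : ℝ) ((hg1.differentiable (by simp) (σ 0)).hasDerivAt)
      ((hσ.differentiable (by simp) 0).hasDerivAt)
    have k' := (k.sub_const (g1 p.1)).unique ((hasDerivAt_id (0 : ℝ)).congr_of_eventuallyEq hσr)
    rw [h] at k'
    simp at k'
  obtain ⟨hD, m, hm, hD1, hD2⟩ := deriv_phiW_sub_along_curve hg1 hg2 hf.smooth_w1 hf.smooth_w2
    hw1 hw2 hσ.contDiffAt hτ.contDiffAt hst (by rwa [hσ0]) (by rwa [hτ0]) hσ'
  rw [hσ0, hτ0] at hD1 hD2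
  set D := fun x => phiW g1 w1 (σ x) - phiW g2 w2 (τ x) with hDdef
  have hD0 : D 0 = 0 := by simp [hDdef, hσ0, hτ0, hφ]
  have hlim := tendsto_div_sq hD hD0 (by rw [hD1, hΦ, mul_zero])
  have hDD : deriv (deriv D) 0 ≠ 0 := by
    rw [hD2 hΦ]; exact mul_ne_zero (pow_ne_zero 2 hm) hΦ'
  have hκ : ContinuousAt (fun x => -(w1 (σ x) * w2 (τ x) * g2 (τ x) ^ 2 /
      (2 * deriv g1 (σ x) * deriv g2 (τ x)))) 0 := by
    refine (ContinuousAt.div ?_ ?_ ?_).neg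
    · exact (((hf.smooth_w1.comp hσ).mul (hf.smooth_w2.comp hτ)).mul
        ((hg2.comp hτ).pow 2)).continuous.continuousAt
    · exact ((contDiff_const.mul (dg1.comp hσ)).mul (dg2.comp hτ)).continuous.continuousAt
    · rw [hσ0, hτ0]
      exact mul_ne_zero (mul_ne_zero two_ne_zero hd1) hd2
  refine aEquiv_momentMap_fCS1p ha hb ?_ ((continuousAt_update_same.2 hlim).mul hκ) ?_ ?_
  · rw [hae.self_of_nhds]
    simp only [hσ0]
    exact div_ne_zero (hw1 _) (mul_ne_zero two_ne_zero hd1)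
  · simp [hσ0, hτ0, hDD, hw1, hw2, hd1, hd2, hn2]
  · filter_upwards [hae, hbe, hst, (dg1.comp hσ).continuous.continuousAt.eventually_ne
      (by simpa [hσ0] using hd1), (dg2.comp hτ).continuous.continuousAt.eventually_ne
      (by simpa [hτ0] using hd2)] with x k1 k2 k3 k4 k5
    have hx : D x = x ^ 2 * Function.update (fun x => D x / x ^ 2) 0 (deriv (deriv D) 0 / 2) x := by
      rcases eq_or_ne x 0 with rfl | hx
      · simp [hD0]
      · rw [Function.update_of_ne hx]
        field_simp
    rw [Pi.mul_apply, ← mul_assoc, ← hx, k1, k2, hDdef]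
    have k6 := left_ne_zero_of_mul_eq_one k3
    have k7 := right_ne_zero_of_mul_eq_one k3
    have k8 : g2 (τ x) = (g1 (σ x))⁻¹ := eq_inv_of_mul_eq_one_right k3
    have k9 := hw1 (σ x)
    have k10 := hw2 (τ x)
    simp only [Function.comp] at k4 k5
    simp only [phiW]
    rw [k8]
    field_simp
    ring

theorem null_combination_relations {A B s t : ℝ → ℝ} {Y Z : ℝ → R3} {x s' t' : ℝ}
    (hA : ContinuousAt A 0) (hB : ContinuousAt B 0) (hs : HasDerivAt s s' 0)
    (ht : HasDerivAt t t' 0) (hY : HasDerivAt Y 0 0) (hZ : ContinuousAt Z 0) (hA0 : A 0 ≠ 0)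
    (h : ∀ᶠ v in nhds 0, ((A v + B v, A v * s v + B v * t v,
      A v * s v ^ 2 + B v * t v ^ 2) : R3) =
        (2 * v) • Y v + (v ^ 2 * (3 * x ^ 2 + 5 * v ^ 2)) • Z v) :
    B 0 = -A 0 ∧ t 0 = s 0 ∧ A 0 * (s' - t') = 2 * ((Y 0).2.1 - s 0 * (Y 0).1) ∧
      (Y 0).2.2 - 2 * s 0 * (Y 0).2.1 + s 0 ^ 2 * (Y 0).1 = 0 ∧
      A 0 * (s' ^ 2 - t' ^ 2) =
        3 * x ^ 2 * ((Z 0).2.2 - 2 * s 0 * (Z 0).2.1 + s 0 ^ 2 * (Z 0).1) := by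
  have h0 := h.self_of_nhds
  simp only [Prod.ext_iff, mul_zero, zero_smul, add_zero, ne_eq, OfNat.ofNat_ne_zero,
    not_false_eq_true, zero_pow, zero_mul, Prod.fst_zero, Prod.snd_zero] at h0
  have hB0 : B 0 = -A 0 := by linarith [h0.1]
  have hts : t 0 = s 0 := by
    have := h0.2.1
    rw [hB0] at this
    exact (mul_left_cancel₀ hA0 (by linarith)).symm
  have hY0 : HasDerivAt (fun v => (Y v).1) 0 0 := by
    simpa using hY.hasFDerivAt.fst.hasDerivAt
  have hY1 : HasDerivAt (fun v => (Y v).2.1) 0 0 := by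
    simpa using hY.hasFDerivAt.snd.fst.hasDerivAt
  have hY2 : HasDerivAt (fun v => (Y v).2.2) 0 0 := by
    simpa using hY.hasFDerivAt.snd.snd.hasDerivAt
  have hZ0 : ContinuousAt (fun v => (Z v).1) 0 := hZ.fst
  have hZ1 : ContinuousAt (fun v => (Z v).2.1) 0 := hZ.snd.fst
  have hZ2 : ContinuousAt (fun v => (Z v).2.2) 0 := hZ.snd.snd
  have le := nhdsWithin_le_nhds (a := (0 : ℝ)) (s := {0}ᶜ)
  have ss := hasDerivAt_iff_tendsto_slope.1 hs
  have st := hasDerivAt_iff_tendsto_slope.1 ht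
  have hlin : HasDerivAt (fun v => (Y v).2.2 - 2 * s 0 * (Y v).2.1 + s 0 ^ 2 * (Y v).1) 0 0 :=
    ((hY2.sub (hY1.const_mul (2 * s 0))).add (hY0.const_mul (s 0 ^ 2))).congr_deriv (by simp)
  have hv : Tendsto (fun v : ℝ => v) (nhdsWithin 0 {0}ᶜ) (nhds 0) := tendsto_id.mono_left le
  have hpunct : ∀ᶠ v in nhdsWithin (0 : ℝ) {0}ᶜ, v ≠ 0 ∧ s v = s 0 + v * slope s 0 v ∧
      t v = s 0 + v * slope t 0 v ∧ A v + B v =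
        2 * v * (Y v).1 + v ^ 2 * (3 * x ^ 2 + 5 * v ^ 2) * (Z v).1 ∧
      A v * s v + B v * t v =
        2 * v * (Y v).2.1 + v ^ 2 * (3 * x ^ 2 + 5 * v ^ 2) * (Z v).2.1 ∧
      A v * s v ^ 2 + B v * t v ^ 2 =
        2 * v * (Y v).2.2 + v ^ 2 * (3 * x ^ 2 + 5 * v ^ 2) * (Z v).2.2 := by
    filter_upwards [h.filter_mono le, self_mem_nhdsWithin] with v hv hv0
    have hv0' : v ≠ 0 := hv0
    refine ⟨hv0, ?_, ?_, by simpa [Prod.ext_iff] using hv⟩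
    · rw [slope_def_field]; field_simp; ring
    · rw [slope_def_field, hts]; field_simp; ring
  have hZc : ContinuousAt (fun v => (Z v).2.2 - 2 * s 0 * (Z v).2.1 + s 0 ^ 2 * (Z v).1) 0 := by
    fun_prop
  have hpoly : ContinuousAt (fun v : ℝ => 3 * x ^ 2 + 5 * v ^ 2) 0 := by fun_prop
  have hquad : (Y 0).2.2 - 2 * s 0 * (Y 0).2.1 + s 0 ^ 2 * (Y 0).1 = 0 := by
    have k1 : Tendsto (fun v => 2 * ((Y v).2.2 - 2 * s 0 * (Y v).2.1 + s 0 ^ 2 * (Y v).1) +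
        v * ((3 * x ^ 2 + 5 * v ^ 2) * ((Z v).2.2 - 2 * s 0 * (Z v).2.1 + s 0 ^ 2 * (Z v).1)))
        (nhdsWithin 0 {0}ᶜ) _ :=
      ((hlin.continuousAt.tendsto.mono_left le).const_mul 2).add
        (hv.mul ((hpoly.mul hZc).tendsto.mono_left le))
    have k2 := hv.mul (((hA.tendsto.mono_left le).mul (ss.pow 2)).add
      ((hB.tendsto.mono_left le).mul (st.pow 2)))
    have := tendsto_nhds_unique (k1.congr' ?_) k2
    · linarith
    · filter_upwards [hpunct] with v ⟨hv0, e1, e2, e3, e4, e5⟩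
      refine mul_left_cancel₀ hv0 ?_
      generalize slope s 0 v = a at *
      generalize slope t 0 v = b at *
      rw [e1, e2] at e4 e5
      linear_combination 2 * s 0 * e4 - e5 - s 0 ^ 2 * e3
  refine ⟨hB0, hts, ?_, hquad, ?_⟩
  · have k1 : Tendsto (fun v => 2 * ((Y v).2.1 - s 0 * (Y v).1) +
        v * ((3 * x ^ 2 + 5 * v ^ 2) * ((Z v).2.1 - s 0 * (Z v).1)))
        (nhdsWithin 0 {0}ᶜ) _ :=
      (((hY1.continuousAt.sub (hY0.continuousAt.const_mul (s 0))).tendsto.mono_left le).const_mul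
        2).add (hv.mul ((hpoly.mul (hZ1.sub (hZ0.const_mul (s 0)))).tendsto.mono_left le))
    have k2 := ((hA.tendsto.mono_left le).mul ss).add ((hB.tendsto.mono_left le).mul st)
    have := tendsto_nhds_unique (k1.congr' ?_) k2
    · rw [hB0] at this
      simp only [Pi.mul_apply, Pi.sub_apply] at this
      linarith
    · filter_upwards [hpunct] with v ⟨hv0, e1, e2, e3, e4, e5⟩
      refine mul_left_cancel₀ hv0 ?_
      generalize slope s 0 v = a at *
      generalize slope t 0 v = b at *
      rw [e1, e2] at e4
      linear_combination s 0 * e3 - e4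
  · have k1 : Tendsto (fun v => 2 * slope (fun v => (Y v).2.2 - 2 * s 0 * (Y v).2.1 +
          s 0 ^ 2 * (Y v).1) 0 v +
        (3 * x ^ 2 + 5 * v ^ 2) * ((Z v).2.2 - 2 * s 0 * (Z v).2.1 + s 0 ^ 2 * (Z v).1))
        (nhdsWithin 0 {0}ᶜ) _ :=
      ((hasDerivAt_iff_tendsto_slope.1 hlin).const_mul 2).add
        ((hpoly.mul hZc).tendsto.mono_left le)
    have k2 := ((hA.tendsto.mono_left le).mul (ss.pow 2)).add
      ((hB.tendsto.mono_left le).mul (st.pow 2))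
    have := tendsto_nhds_unique (k1.congr' ?_) k2
    · rw [hB0] at this
      simp only [Pi.mul_apply] at this
      linarith
    · filter_upwards [hpunct] with v ⟨hv0, e1, e2, e3, e4, e5⟩
      rw [slope_def_field, hquad]
      simp only [sub_zero]
      generalize slope s 0 v = a at *
      generalize slope t 0 v = b at *
      rw [e1, e2] at e4 e5
      field_simp
      refine mul_left_cancel₀ hv0 ?_
      linear_combination 2 * s 0 * e4 - e5 - s 0 ^ 2 * e3

/-- Linear coordinates on `𝕃³` in which the null directions are the vectors
`(1, s, s²)`. -/
def nullFrame : R3 →L[ℝ] R3 :=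
  LinearMap.toContinuousLinearMap
    { toFun := fun Y => ((Y.2.1 - Y.1) / 2, Y.2.2 / 2, -(Y.1 + Y.2.1) / 2)
      map_add' := fun a b => by
        simp only [Prod.fst_add, Prod.snd_add, Prod.mk_add_mk]
        refine Prod.ext ?_ (Prod.ext ?_ ?_) <;> ring_nf
      map_smul' := fun c a => by
        simp only [Prod.smul_fst, Prod.smul_snd, smul_eq_mul, RingHom.id_apply, Prod.smul_mk]
        refine Prod.ext ?_ (Prod.ext ?_ ?_) <;> ring_nf }

theorem nullFrame_apply (Y : R3) :
    nullFrame Y = ((Y.2.1 - Y.1) / 2, Y.2.2 / 2, -(Y.1 + Y.2.1) / 2) := rfl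

theorem nullFrame_injective : Function.Injective nullFrame := by
  refine (injective_iff_map_eq_zero _).2 fun Y hY => ?_
  simp only [nullFrame_apply, Prod.ext_iff, Prod.fst_zero, Prod.snd_zero] at hY
  obtain ⟨h1, h2, h3⟩ := hY
  refine Prod.ext ?_ (Prod.ext ?_ ?_) <;> simp only [Prod.fst_zero, Prod.snd_zero] <;> linarith

theorem fderiv_nullFrame_comp {f : R2 → R3} {g1 g2 w1 w2 : ℝ → ℝ} (hf : IsGTMS f g1 g2 w1 w2)
    {Ξ : R2 → R2} {q : R2} (hΞ : DifferentiableAt ℝ Ξ q) (hq : g2 (Ξ q).2 ≠ 0) (w : R2) :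
    let a := w1 (Ξ q).1 / 2 * (fderiv ℝ Ξ q w).1
    let b := -(g2 (Ξ q).2 ^ 2 * w2 (Ξ q).2 / 2 * (fderiv ℝ Ξ q w).2)
    fderiv ℝ (fun q => nullFrame (f (Ξ q))) q w =
      (a + b, a * g1 (Ξ q).1 + b * (g2 (Ξ q).2)⁻¹,
        a * g1 (Ξ q).1 ^ 2 + b * (g2 (Ξ q).2)⁻¹ ^ 2) := by
  intro a b
  have h := nullFrame.hasFDerivAt.comp q ((hf.hasFDerivAt (Ξ q)).comp q hΞ.hasFDerivAt)
  have : fderiv ℝ (fun q => nullFrame (f (Ξ q))) q = _ := h.fderiv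
  rw [this]
  simp only [a, b, ContinuousLinearMap.comp_apply, add_apply, ContinuousLinearMap.smulRight_apply,
    ContinuousLinearMap.coe_fst', ContinuousLinearMap.coe_snd', nullFrame_apply, Prod.fst_add,
    Prod.snd_add, Prod.smul_fst, Prod.smul_snd, smul_eq_mul]
  refine Prod.ext ?_ (Prod.ext ?_ ?_) <;> field_simp <;> ring

theorem contDiff_fCS1p : ContDiff ℝ (⊤ : ℕ∞) fCS1p := by
  unfold fCS1p
  fun_prop

theorem fderiv_fCS1p_apply (q w : R2) : fderiv ℝ fCS1p q w = (w.1, 2 * q.2 * w.2,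
    2 * q.1 * q.2 ^ 3 * w.1 + q.2 ^ 2 * (3 * q.1 ^ 2 + 5 * q.2 ^ 2) * w.2) := by
  have h1 : HasFDerivAt (fun q : R2 => q.1) (ContinuousLinearMap.fst ℝ ℝ ℝ) q := hasFDerivAt_fst
  have h2 : HasFDerivAt (fun q : R2 => q.2) (ContinuousLinearMap.snd ℝ ℝ ℝ) q := hasFDerivAt_snd
  have h : HasFDerivAt fCS1p _ q :=
    h1.prodMk ((h2.pow 2).prodMk ((h2.pow 3).mul ((h1.pow 2).add (h2.pow 2))))
  rw [h.fderiv]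
  refine Prod.ext ?_ (Prod.ext ?_ ?_) <;> simp
  ring

theorem hasDerivAt_fCS1p_snd (x : ℝ) : HasDerivAt (fun v => fCS1p (x, v)) 0 0 := by
  have h := ((contDiff_fCS1p.differentiable (by simp)) (x, 0)).hasFDerivAt.comp_hasDerivAt
    (0 : ℝ) ((hasDerivAt_const (0 : ℝ) x).prodMk (hasDerivAt_id (0 : ℝ)))
  rw [fderiv_fCS1p_apply] at h
  exact h.congr_deriv (by simp)

theorem fCS1p_row_relations {f : R2 → R3} {g1 g2 w1 w2 : ℝ → ℝ} (hf : IsGTMS f g1 g2 w1 w2)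
    (hw1 : ∀ u, w1 u ≠ 0) (hw2 : ∀ v, w2 v ≠ 0) {Ξ : R2 → R2} (hΞ : ContDiff ℝ (⊤ : ℕ∞) Ξ)
    {G : R3 → R3} (hG : ContDiff ℝ (⊤ : ℕ∞) G) {x S T a : ℝ} {Y Z : R3}
    (hS : S = (Ξ (x, 0)).1) (hT : T = (Ξ (x, 0)).2)
    (ha : a = w1 S / 2 * (fderiv ℝ Ξ (x, 0) (0, 1)).1) (ha0 : a ≠ 0) (hT0 : g2 T ≠ 0)
    (hY : Y = fderiv ℝ G (fCS1p (x, 0)) (0, 1, 0)) (hZ : Z = fderiv ℝ G (fCS1p (x, 0)) (0, 0, 1))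
    (hev : ∀ᶠ v in nhds (0 : ℝ), g2 (Ξ (x, v)).2 ≠ 0 ∧
      fderiv ℝ (fun q => nullFrame (f (Ξ q))) (x, v) = fderiv ℝ (fun q => G (fCS1p q)) (x, v)) :
    g1 S * g2 T = 1 ∧
      a ^ 2 * g1 S ^ 2 * (phiW g1 w1 S + phiW g2 w2 T) = Y.2.1 - g1 S * Y.1 ∧
      Y.2.2 - 2 * g1 S * Y.2.1 + g1 S ^ 2 * Y.1 = 0 ∧
      4 * a ^ 3 * g1 S ^ 4 * (phiW g1 w1 S + phiW g2 w2 T) * (phiW g1 w1 S - phiW g2 w2 T) =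
        3 * x ^ 2 * (Z.2.2 - 2 * g1 S * Z.2.1 + g1 S ^ 2 * Z.1) := by
  have hg1 := hf.smooth_g1.continuous
  have hg2 := hf.smooth_g2.continuous
  have hw1c := hf.smooth_w1.continuous
  have hw2c := hf.smooth_w2.continuous
  have hΞc := hΞ.continuous
  have hdΞ : Continuous (fderiv ℝ Ξ) := hΞ.continuous_fderiv (by simp)
  have hdG : Continuous (fderiv ℝ G) := hG.continuous_fderiv (by simp)
  have hfc := contDiff_fCS1p.continuous
  have hrow : HasDerivAt (fun v => Ξ (x, v)) (fderiv ℝ Ξ (x, 0) (0, 1)) 0 :=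
    ((hΞ.differentiable (by simp)) (x, 0)).hasFDerivAt.comp_hasDerivAt
      (0 : ℝ) ((hasDerivAt_const (0 : ℝ) x).prodMk (hasDerivAt_id (0 : ℝ)))
  have hrowS : HasDerivAt (fun v => (Ξ (x, v)).1) (fderiv ℝ Ξ (x, 0) (0, 1)).1 0 := by
    simpa using hrow.hasFDerivAt.fst.hasDerivAt
  have hrowT : HasDerivAt (fun v => (Ξ (x, v)).2) (fderiv ℝ Ξ (x, 0) (0, 1)).2 0 := by
    simpa using hrow.hasFDerivAt.snd.hasDerivAt
  have hs : HasDerivAt (fun v => g1 (Ξ (x, v)).1) (deriv g1 S * (fderiv ℝ Ξ (x, 0) (0, 1)).1) 0 :=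
    HasDerivAt.comp (h := fun v => (Ξ (x, v)).1) (0 : ℝ)
      (hS ▸ (hf.smooth_g1.differentiable (by simp) _).hasDerivAt) hrowS
  have ht := (HasDerivAt.comp (h := fun v => (Ξ (x, v)).2) (0 : ℝ)
      (((hf.smooth_g2.differentiable (by simp) (Ξ (x, 0)).2)).hasDerivAt) hrowT).inv
        (by simpa [← hT] using hT0)
  have hYd : HasDerivAt (fun v => fderiv ℝ G (fCS1p (x, v)) (0, 1, 0)) 0 0 := by
    have h1 : Differentiable ℝ (fun P => fderiv ℝ G P (0, 1, 0)) :=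
      ((hG.fderiv_right (m := (⊤ : ℕ∞)) (by simp)).clm_apply contDiff_const).differentiable
        (by simp)
    have h2 := (h1 (fCS1p (x, 0))).hasFDerivAt.comp_hasDerivAt (0 : ℝ) (hasDerivAt_fCS1p_snd x)
    rwa [map_zero] at h2
  have key := null_combination_relations (x := x)
    (A := fun v => w1 (Ξ (x, v)).1 / 2 * (fderiv ℝ Ξ (x, v) (0, 1)).1)
    (B := fun v => -(g2 (Ξ (x, v)).2 ^ 2 * w2 (Ξ (x, v)).2 / 2 * (fderiv ℝ Ξ (x, v) (0, 1)).2))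
    (Z := fun v => fderiv ℝ G (fCS1p (x, v)) (0, 0, 1))
    (by fun_prop) (by fun_prop) hs ht hYd (by fun_prop) (by simpa [← hS, ← ha] using ha0) ?_
  · simp only [← hS, ← hT, ← ha, ← hY, ← hZ, Function.comp_apply, Pi.inv_apply] at key
    generalize (fderiv ℝ Ξ (x, 0) (0, 1)).1 = b at *
    generalize (fderiv ℝ Ξ (x, 0) (0, 1)).2 = c at *
    obtain ⟨k1, k2, k3, k4, k5⟩ := key
    have h1 := hw1 S
    have h2 := hw2 T
    have hb : b = 2 * a / w1 S := by rw [ha]; field_simp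
    have hc : c = 2 * a / (g2 T ^ 2 * w2 T) := by
      field_simp
      linarith
    have hst : g1 S * g2 T = 1 := by rw [← k2]; field_simp
    have e1 : deriv g1 S * b = 2 * a * g1 S ^ 2 * phiW g1 w1 S := by
      have : g1 S ≠ 0 := left_ne_zero_of_mul_eq_one hst
      rw [hb, phiW]; field_simp
    have e2 : -(deriv g2 T * c) / g2 T ^ 2 = -(2 * a * g1 S ^ 2 * phiW g2 w2 T) := by
      rw [hc, ← k2, phiW]; field_simp
    rw [e1, e2] at k3 k5
    refine ⟨hst, by linarith, k4, ?_⟩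
    linarith
  · filter_upwards [hev] with v ⟨hv1, hv2⟩
    have h := fderiv_nullFrame_comp hf ((hΞ.differentiable (by simp)) (x, v)) hv1 (0, 1)
    have h' : fderiv ℝ (fun q => G (fCS1p q)) (x, v) = _ :=
      (((hG.differentiable (by simp)) _).hasFDerivAt.comp (x, v)
        ((contDiff_fCS1p.differentiable (by simp)) (x, v)).hasFDerivAt).fderiv
    rw [hv2, h', ContinuousLinearMap.comp_apply, fderiv_fCS1p_apply] at h
    refine h.symm.trans ?_
    rw [← map_smul, ← map_smul, ← map_add]
    congr 1
    simp

theorem frame_nondegenerate {L : R3 →L[ℝ] R3} (hL : Function.Injective L) {c s : ℝ} {Y Z : R3}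
    (h1 : L (1, 0, 0) = (c, c * s, c * s ^ 2)) (h2 : L (0, 1, 0) = Y) (h3 : L (0, 0, 1) = Z)
    (hY : Y.2.2 - 2 * s * Y.2.1 + s ^ 2 * Y.1 = 0) :
    Y.2.1 - s * Y.1 ≠ 0 ∧ Z.2.2 - 2 * s * Z.2.1 + s ^ 2 * Z.1 ≠ 0 := by
  have hL0 := (injective_iff_map_eq_zero L).1 hL
  constructor
  · intro h
    have e1 : Y.2.1 = s * Y.1 := by linarith
    have e2 : Y.2.2 = s ^ 2 * Y.1 := by rw [e1] at hY; linarith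
    have hz : L (c • (0, 1, 0) - Y.1 • (1, 0, 0)) = 0 := by
      rw [map_sub, map_smul, map_smul, h1, h2]
      refine Prod.ext ?_ (Prod.ext ?_ ?_) <;> simp [e1, e2] <;> ring
    have hc := hL0 _ hz
    simp only [Prod.ext_iff, Prod.fst_sub, Prod.snd_sub, Prod.smul_mk, smul_eq_mul] at hc
    have hc0 : c = 0 := by simpa using hc.2.1
    have : ((1, 0, 0) : R3) = 0 := hL0 _ (by simp [h1, hc0])
    simp [Prod.ext_iff] at this
  · intro h
    obtain ⟨P, hP⟩ := (LinearMap.injective_iff_surjective (f := L.toLinearMap)).1 hL (0, 0, 1)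
    have hP' : L P = (0, 0, 1) := hP
    have hdec : P = P.1 • ((1, 0, 0) : R3) + P.2.1 • ((0, 1, 0) : R3) +
        P.2.2 • ((0, 0, 1) : R3) := by
      refine Prod.ext ?_ (Prod.ext ?_ ?_) <;> simp
    rw [hdec, map_add, map_add, map_smul, map_smul, map_smul, h1, h2, h3] at hP'
    simp only [Prod.ext_iff, Prod.fst_add, Prod.snd_add, Prod.smul_fst, Prod.smul_snd,
      smul_eq_mul] at hP'
    obtain ⟨p1, p2, p3⟩ := hP'
    have : (1 : ℝ) = 0 := by
      linear_combination -p3 + 2 * s * p2 - s ^ 2 * p1 + P.2.1 * hY + P.2.2 * h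
    exact one_ne_zero this

theorem fCS1p_axis_relations {f : R2 → R3} {g1 g2 w1 w2 : ℝ → ℝ} (hf : IsGTMS f g1 g2 w1 w2)
    (hw1 : ∀ u, w1 u ≠ 0) (hw2 : ∀ v, w2 v ≠ 0) {Ξ : R2 → R2} (hΞ : ContDiff ℝ (⊤ : ℕ∞) Ξ)
    (hp : g1 (Ξ (0, 0)).1 * g2 (Ξ (0, 0)).2 = 1)
    (hΞi : Function.Injective (fderiv ℝ Ξ (0, 0))) {G : R3 → R3} (hG : ContDiff ℝ (⊤ : ℕ∞) G)
    (hGi : Function.Injective (fderiv ℝ G (fCS1p (0, 0))))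
    (hev : ∀ᶠ q in nhds ((0, 0) : R2), nullFrame (f (Ξ q)) = G (fCS1p q)) :
    ∃ a lam : ℝ → ℝ, ContinuousAt a 0 ∧ ContinuousAt lam 0 ∧ a 0 ≠ 0 ∧ lam 0 ≠ 0 ∧
      phiW g1 w1 (Ξ (0, 0)).1 + phiW g2 w2 (Ξ (0, 0)).2 ≠ 0 ∧
      ∀ᶠ x in nhds 0, g1 (Ξ (x, 0)).1 * g2 (Ξ (x, 0)).2 = 1 ∧
        4 * a x ^ 3 * g1 (Ξ (x, 0)).1 ^ 4 *
          (phiW g1 w1 (Ξ (x, 0)).1 + phiW g2 w2 (Ξ (x, 0)).2) *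
          (phiW g1 w1 (Ξ (x, 0)).1 - phiW g2 w2 (Ξ (x, 0)).2) = 3 * x ^ 2 * lam x := by
  have hg1 := hf.smooth_g1.continuous
  have hg2 := hf.smooth_g2.continuous
  have hw1c := hf.smooth_w1.continuous
  have hΞc := hΞ.continuous
  have hdΞ : Continuous (fderiv ℝ Ξ) := hΞ.continuous_fderiv (by simp)
  have hdG : Continuous (fderiv ℝ G) := hG.continuous_fderiv (by simp)
  have hfc := contDiff_fCS1p.continuous
  have hs0 : g1 (Ξ (0, 0)).1 ≠ 0 := left_ne_zero_of_mul_eq_one hp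
  have ht0 : g2 (Ξ (0, 0)).2 ≠ 0 := right_ne_zero_of_mul_eq_one hp
  have hinv : (g2 (Ξ (0, 0)).2)⁻¹ = g1 (Ξ (0, 0)).1 := by field_simp; linarith
  have hid : ∀ᶠ q in nhds ((0, 0) : R2), g2 (Ξ q).2 ≠ 0 ∧
      fderiv ℝ (fun q => nullFrame (f (Ξ q))) q = fderiv ℝ (fun q => G (fCS1p q)) q := by
    have h1 : ∀ᶠ q in nhds ((0, 0) : R2), g2 (Ξ q).2 ≠ 0 :=
      ContinuousAt.eventually_ne (g := fun q => g2 (Ξ q).2) (by fun_prop) ht0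
    filter_upwards [h1, hev.eventually_nhds] with q h1 h2
    exact ⟨h1, EventuallyEq.fderiv_eq h2⟩
  have hfd : ∀ w, fderiv ℝ (fun q => nullFrame (f (Ξ q))) (0, 0) w =
      fderiv ℝ G (fCS1p (0, 0)) (w.1, 0, 0) := by
    intro w
    have h' : fderiv ℝ (fun q => G (fCS1p q)) (0, 0) = _ :=
      (((hG.differentiable (by simp)) _).hasFDerivAt.comp ((0, 0) : R2)
        ((contDiff_fCS1p.differentiable (by simp)) (0, 0)).hasFDerivAt).fderiv
    rw [hid.self_of_nhds.2, h', ContinuousLinearMap.comp_apply, fderiv_fCS1p_apply]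
    congr 1
    simp
  have hfE := fun w =>
    (fderiv_nullFrame_comp hf ((hΞ.differentiable (by simp)) (0, 0)) ht0 w).symm.trans (hfd w)
  rw [hinv] at hfE
  set a : ℝ → ℝ := fun x => w1 (Ξ (x, 0)).1 / 2 * (fderiv ℝ Ξ (x, 0) (0, 1)).1 with ha
  have hac : ContinuousAt a 0 := by fun_prop
  have ha0 : a 0 ≠ 0 := by
    intro h0
    have h := hfE (0, 1)
    simp only [Prod.mk_zero_zero, map_zero, Prod.ext_iff, Prod.fst_zero] at h
    simp only [ha, mul_eq_zero, div_eq_zero_iff, hw1, OfNat.ofNat_ne_zero, or_self,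
      false_or] at h0
    have h2 := h.1
    simp only [Prod.mk_zero_zero] at h0 ht0
    rw [h0, mul_zero, zero_add, neg_eq_zero, mul_eq_zero] at h2
    have h3 := h2.resolve_left (by have := hw2 (Ξ 0).2; positivity)
    have : ((0, 1) : R2) = 0 := (injective_iff_map_eq_zero _).1 hΞi _ (Prod.ext h0 h3)
    simp [Prod.ext_iff] at this
  refine ⟨a, fun x => (fderiv ℝ G (fCS1p (x, 0)) (0, 0, 1)).2.2 -
    2 * g1 (Ξ (x, 0)).1 * (fderiv ℝ G (fCS1p (x, 0)) (0, 0, 1)).2.1 +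
    g1 (Ξ (x, 0)).1 ^ 2 * (fderiv ℝ G (fCS1p (x, 0)) (0, 0, 1)).1, hac, by fun_prop, ha0, ?_⟩
  have hrow : ∀ᶠ x in nhds (0 : ℝ), a x ≠ 0 ∧ g2 (Ξ (x, 0)).2 ≠ 0 ∧
      ∀ᶠ v in nhds (0 : ℝ), g2 (Ξ (x, v)).2 ≠ 0 ∧
        fderiv ℝ (fun q => nullFrame (f (Ξ q))) (x, v) = fderiv ℝ (fun q => G (fCS1p q)) (x, v) := by
    rw [nhds_prod_eq] at hid
    filter_upwards [hac.eventually_ne ha0, hid.curry] with x h1 h2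
    exact ⟨h1, h2.self_of_nhds.1, h2⟩
  have hrel := hrow.mono fun x hx => fCS1p_row_relations hf hw1 hw2 hΞ hG (x := x) rfl rfl rfl
    hx.1 hx.2.1 rfl rfl hx.2.2
  obtain ⟨-, r1, r2, -⟩ := hrel.self_of_nhds
  have hC := hfE (1, 0)
  rw [← add_mul, ← add_mul] at hC
  obtain ⟨n1, n2⟩ := frame_nondegenerate hGi hC.symm rfl rfl r2
  refine ⟨n2, fun h => n1 ?_, hrel.mono fun x hx => ⟨hx.1, hx.2.2.2⟩⟩
  rw [← r1, h, mul_zero]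

theorem deriv_eq_zero_of_mul_eq_sq {D K lam : ℝ → ℝ} (hD : ContDiffAt ℝ (⊤ : ℕ∞) D 0)
    (hK : ContinuousAt K 0) (hlam : ContinuousAt lam 0) (hK0 : K 0 ≠ 0) (hlam0 : lam 0 ≠ 0)
    (h : ∀ᶠ x in nhds 0, K x * D x = x ^ 2 * lam x) :
    D 0 = 0 ∧ deriv D 0 = 0 ∧ deriv (deriv D) 0 ≠ 0 := by
  have hD0 : D 0 = 0 := by
    have := h.self_of_nhds
    simpa [hK0] using this
  have le := nhdsWithin_le_nhds (a := (0 : ℝ)) (s := {0}ᶜ)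
  have hq : Tendsto (fun x => lam x / K x) (nhdsWithin 0 {0}ᶜ) (nhds (lam 0 / K 0)) :=
    (hlam.div hK hK0).tendsto.mono_left le
  have hev : ∀ᶠ x in nhdsWithin (0 : ℝ) {0}ᶜ, x ≠ 0 ∧ D x = x ^ 2 * (lam x / K x) := by
    filter_upwards [h.filter_mono le, (hK.eventually_ne hK0).filter_mono le,
      self_mem_nhdsWithin] with x h1 h2 h3
    refine ⟨h3, ?_⟩
    field_simp
    linarith
  have hd : deriv D 0 = 0 := by
    have h1 := hasDerivAt_iff_tendsto_slope.1 (hD.differentiableAt (by simp)).hasDerivAt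
    have h2 : Tendsto (fun x : ℝ => x * (lam x / K x)) (nhdsWithin 0 {0}ᶜ)
        (nhds (0 * (lam 0 / K 0))) :=
      (tendsto_id.mono_left le).mul hq
    rw [zero_mul] at h2
    refine tendsto_nhds_unique (h1.congr' ?_) h2
    filter_upwards [hev] with x ⟨hx, hx'⟩
    rw [slope_def_field, hD0, sub_zero, sub_zero, hx']
    field_simp
  refine ⟨hD0, hd, fun h2 => ?_⟩
  have h3 := tendsto_nhds_unique ((tendsto_div_sq hD hD0 hd).congr' ?_) hq
  · rw [h2, zero_div] at h3
    exact div_ne_zero hlam0 hK0 h3.symm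
  · filter_upwards [hev] with x ⟨hx, hx'⟩
    rw [hx']
    field_simp

theorem conditions_of_aEquiv_fCS1p {f : R2 → R3} {g1 g2 w1 w2 : ℝ → ℝ}
    (hf : IsGTMS f g1 g2 w1 w2) (hw1 : ∀ u, w1 u ≠ 0) (hw2 : ∀ v, w2 v ≠ 0) {p : R2}
    (hp : g1 p.1 * g2 p.2 = 1) (h : AEquiv f p fCS1p (0, 0)) :
    phiW g1 w1 p.1 - phiW g2 w2 p.2 = 0 ∧ phiW g1 w1 p.1 + phiW g2 w2 p.2 ≠ 0 ∧
      PhiW g1 w1 p.1 + PhiW g2 w2 p.2 = 0 ∧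
      g1 p.1 / deriv g1 p.1 * deriv (PhiW g1 w1) p.1
        - g2 p.2 / deriv g2 p.2 * deriv (PhiW g2 w2) p.2 ≠ 0 := by
  obtain ⟨Φ, Ψ, hΦ, hΦp, hΨ, hΨp, hev⟩ := h
  obtain ⟨Ξ, hΞ, hΞp, -, hΞr, hΞi⟩ := hΦ.exists_contDiff_inverse
  obtain ⟨Θ, hΘ, -, hΘl, -, hΘi⟩ := hΨ.exists_contDiff_inverse
  rw [hΦp] at hΞp hΞr hΞi
  rw [hΨp] at hΘi
  have hG : ContDiff ℝ (⊤ : ℕ∞) fun P => nullFrame (Θ P) := nullFrame.contDiff.comp hΘ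
  have hGi : Function.Injective (fderiv ℝ (fun P => nullFrame (Θ P)) (fCS1p (0, 0))) := by
    have h1 : fderiv ℝ (fun P => nullFrame (Θ P)) (fCS1p (0, 0)) = _ :=
      (nullFrame.hasFDerivAt.comp (fCS1p (0, 0))
        ((hΘ.differentiable (by simp)) (fCS1p (0, 0))).hasFDerivAt).fderiv
    rw [h1]
    exact nullFrame_injective.comp hΘi
  have hΞt : Tendsto Ξ (nhds (0, 0)) (nhds p) := by
    have := hΞ.continuous.tendsto (0, 0)
    rwa [hΞp] at this
  have hrep : ∀ᶠ q in nhds ((0, 0) : R2), nullFrame (f (Ξ q)) = nullFrame (Θ (fCS1p q)) := by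
    filter_upwards [hΞr, hΞt.eventually hev,
      (hf.smooth_f.continuous.continuousAt.tendsto.comp hΞt).eventually hΘl] with q h1 h2 h3
    rw [h1] at h2
    rw [← h2]
    exact congrArg nullFrame h3.symm
  obtain ⟨a, lam, hac, hlc, ha0, hl0, hsum, hrel⟩ := fCS1p_axis_relations hf hw1 hw2 hΞ
    (by rwa [hΞp]) hΞi hG hGi hrep
  have hrow : HasDerivAt (fun x => Ξ (x, 0)) (fderiv ℝ Ξ (0, 0) (1, 0)) 0 :=
    HasFDerivAt.comp_hasDerivAt (f := fun x : ℝ => ((x, 0) : R2)) (0 : ℝ)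
      ((hΞ.differentiable (by simp)) (0, 0)).hasFDerivAt ((hasDerivAt_id (0 : ℝ)).prodMk (hasDerivAt_const (0 : ℝ) (0 : ℝ)))
  have hσd : HasDerivAt (fun x => (Ξ (x, 0)).1) (fderiv ℝ Ξ (0, 0) (1, 0)).1 0 := by
    simpa using hrow.hasFDerivAt.fst.hasDerivAt
  have hτd : HasDerivAt (fun x => (Ξ (x, 0)).2) (fderiv ℝ Ξ (0, 0) (1, 0)).2 0 := by
    simpa using hrow.hasFDerivAt.snd.hasDerivAt
  have hσ : ContDiff ℝ (⊤ : ℕ∞) fun x : ℝ => (Ξ (x, 0)).1 := by fun_prop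
  have hτ : ContDiff ℝ (⊤ : ℕ∞) fun x : ℝ => (Ξ (x, 0)).2 := by fun_prop
  have hline : fderiv ℝ Ξ (0, 0) (1, 0) ≠ 0 := fun h0 => by
    have : ((1, 0) : R2) = 0 := (injective_iff_map_eq_zero _).1 hΞi _ h0
    simp [Prod.ext_iff] at this
  generalize fderiv ℝ Ξ (0, 0) (1, 0) = d at hσd hτd hline
  set σ : ℝ → ℝ := fun x => (Ξ (x, 0)).1 with hσdef
  set τ : ℝ → ℝ := fun x => (Ξ (x, 0)).2 with hτdef
  have hσ0 : σ 0 = p.1 := by rw [hσdef]; exact congrArg Prod.fst hΞp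
  have hτ0 : τ 0 = p.2 := by rw [hτdef]; exact congrArg Prod.snd hΞp
  have hst : ∀ᶠ x in nhds 0, g1 (σ x) * g2 (τ x) = 1 := hrel.mono fun x hx => hx.1
  rw [hΞp] at hsum
  have hs0 : g1 p.1 ≠ 0 := left_ne_zero_of_mul_eq_one hp
  have hφ : phiW g1 w1 p.1 = phiW g2 w2 p.2 := by
    have h0 := hrel.self_of_nhds.2
    rw [hΞp] at h0
    have : 4 * a 0 ^ 3 * g1 p.1 ^ 4 * (phiW g1 w1 p.1 + phiW g2 w2 p.2) ≠ 0 :=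
      mul_ne_zero (by positivity) hsum
    refine sub_eq_zero.1 (mul_left_cancel₀ this ?_)
    rw [h0]
    ring
  have hφ1 : phiW g1 w1 p.1 ≠ 0 := fun h0 => hsum (by rw [← hφ, h0, add_zero])
  have hφ2 : phiW g2 w2 p.2 ≠ 0 := hφ ▸ hφ1
  have hd1 : deriv g1 p.1 ≠ 0 := fun h0 => hφ1 (by rw [phiW, h0, zero_div])
  have hd2 : deriv g2 p.2 ≠ 0 := fun h0 => hφ2 (by rw [phiW, h0, zero_div])
  have hσ' : deriv σ 0 ≠ 0 := by
    rw [hσd.deriv]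
    intro h0
    have e1 : HasDerivAt (fun x => g1 (σ x)) (deriv g1 (σ 0) * d.1) 0 :=
      HasDerivAt.comp (h := σ) (0 : ℝ) (hf.smooth_g1.differentiable (by simp) _).hasDerivAt hσd
    have e2 : HasDerivAt (fun x => g2 (τ x)) (deriv g2 (τ 0) * d.2) 0 :=
      HasDerivAt.comp (h := τ) (0 : ℝ) (hf.smooth_g2.differentiable (by simp) _).hasDerivAt hτd
    have e3 := (e1.mul e2).unique ((hasDerivAt_const (0 : ℝ) (1 : ℝ)).congr_of_eventuallyEq hst)
    rw [h0, mul_zero, zero_mul, zero_add, hσ0, hτ0] at e3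
    have h2 : d.2 = 0 := by simpa [hs0, hd2] using e3
    exact hline (Prod.ext h0 h2)
  obtain ⟨hDs, m, hm, hDd, hDdd⟩ := deriv_phiW_sub_along_curve hf.smooth_g1 hf.smooth_g2
    hf.smooth_w1 hf.smooth_w2 hw1 hw2 hσ.contDiffAt hτ.contDiffAt hst (hσ0 ▸ hd1) (hτ0 ▸ hd2) hσ'
  have ht0 : g2 p.2 ≠ 0 := right_ne_zero_of_mul_eq_one hp
  have c1 : ContinuousAt (fun x => phiW g1 w1 (σ x)) 0 :=
    ContinuousAt.comp (f := σ) (g := phiW g1 w1) (hσ0 ▸ (contDiffAt_phiW hf.smooth_g1 hf.smooth_w1 hs0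
      (hw1 _)).continuousAt) hσ.continuous.continuousAt
  have c2 : ContinuousAt (fun x => phiW g2 w2 (τ x)) 0 :=
    ContinuousAt.comp (f := τ) (g := phiW g2 w2) (hτ0 ▸ (contDiffAt_phiW hf.smooth_g2 hf.smooth_w2 ht0
      (hw2 _)).continuousAt) hτ.continuous.continuousAt
  have c3 : ContinuousAt (fun x => g1 (σ x)) 0 :=
    (hf.smooth_g1.continuous.comp hσ.continuous).continuousAt
  obtain ⟨-, hD1, hD2⟩ := deriv_eq_zero_of_mul_eq_sq (lam := fun x => 3 * lam x)
    (K := fun x => 4 * a x ^ 3 * g1 (σ x) ^ 4 * (phiW g1 w1 (σ x) + phiW g2 w2 (τ x))) hDs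
    (((continuousAt_const.mul (hac.pow 3)).mul (c3.pow 4)).mul (c1.add c2))
    (continuousAt_const.mul hlc)
    (by
      simp only [hσ0, hτ0]
      exact mul_ne_zero (by positivity) hsum)
    (mul_ne_zero three_ne_zero hl0)
    (hrel.mono fun x hx => hx.2.trans (by ring))
  rw [hσ0, hτ0] at hDd hDdd
  rw [hDd] at hD1
  have hΦ0 := (mul_eq_zero.1 hD1).resolve_left hm
  rw [hDdd hΦ0] at hD2
  exact ⟨sub_eq_zero.2 hφ, hsum, hΦ0, right_ne_zero_of_mul hD2⟩

/-- criterion for the cuspidal S₁⁺ singularity on a minface. -/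
theorem cuspidal_S1_plus_criterion
    (f : R2 → R3) (g1 g2 w1 w2 : ℝ → ℝ) (hf : IsGTMS f g1 g2 w1 w2)
    (hw1 : ∀ u, w1 u ≠ 0) (hw2 : ∀ v, w2 v ≠ 0)
    (p : R2) (hp : g1 p.1 * g2 p.2 = 1) :
    AEquiv f p fCS1p (0, 0) ↔
      (phiW g1 w1 p.1 - phiW g2 w2 p.2 = 0 ∧
       phiW g1 w1 p.1 + phiW g2 w2 p.2 ≠ 0 ∧
       PhiW g1 w1 p.1 + PhiW g2 w2 p.2 = 0 ∧
       g1 p.1 / deriv g1 p.1 * deriv (PhiW g1 w1) p.1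
         - g2 p.2 / deriv g2 p.2 * deriv (PhiW g2 w2) p.2 ≠ 0) := by
  refine ⟨conditions_of_aEquiv_fCS1p hf hw1 hw2 hp, fun ⟨h1, h2, h3, h4⟩ => ?_⟩
  have h := sub_eq_zero.1 h1
  exact aEquiv_fCS1p_of_conditions hf hw1 hw2 hp h (fun h0 => h2 (by rw [← h, h0, add_zero])) h3 h4
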